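/- Suppose the star-connected occupied component C(0) containing the origin is finite and nonempty, and let E_1, …, E_n be the distinct outermost boundary cycles, i.e. the distinct cycles among {D_k : S_k ∈ C(0)}. Let H_cyc be the graph with vertex set {1, …, n} in which i and j (i ≠ j) are adjacent if and only if E_i and E_j share a corner. Then H_cyc is a tree. -/

import Mathlib

/-!
Common framework: tile ℝ² into closed unit squares indexed by `ℤ²`, with corners
forming a translate of `ℤ²` and the origin the centre of the square `S₀` (index `(0,0)`).
A cycle is identified with its edge set (a set of unordered pairs of corners);
its interior (resp. exterior) is the union of the bounded (resp. unbounded)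
connected components of the complement of the closed curve it traces in the plane.
-/

/-- Corners of the grid squares, indexed by `ℤ²`. -/
abbrev GridV := ℤ × ℤ

/-- Embedding of corners into the plane: the square of index `z` is
`[z₁ - 1/2, z₁ + 1/2] × [z₂ - 1/2, z₂ + 1/2]`, so the origin is the centre of `S₀`. -/
noncomputable def toPlane (v : GridV) : ℝ × ℝ := ((v.1 : ℝ) - 1 / 2, (v.2 : ℝ) - 1 / 2)

/-- The closed unit square of index `z`. -/
def squareSet (z : GridV) : Set (ℝ × ℝ) :=
  Set.Icc ((z.1 : ℝ) - 1 / 2, (z.2 : ℝ) - 1 / 2) ((z.1 : ℝ) + 1 / 2, (z.2 : ℝ) + 1 / 2)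

/-- The four edges (unit segments) of the square of index `z`, as unordered pairs of corners. -/
def squareEdges (z : GridV) : Set (Sym2 GridV) :=
  {s(z, z + (1, 0)), s(z + (1, 0), z + (1, 1)), s(z + (1, 1), z + (0, 1)), s(z + (0, 1), z)}

/-- Adjacency of corners in the full grid graph `G`: Euclidean distance one. -/
def GridAdj (u v : GridV) : Prop := |u.1 - v.1| + |u.2 - v.2| = 1

/-- A cycle in the full grid graph: a cyclic sequence `(v₀, …, v_{n-1}, v₀)` of
distinct corners with consecutive corners adjacent. -/
structure GridCycle where
  n : ℕ
  hn : 3 ≤ n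
  f : ZMod n → GridV
  inj : Function.Injective f
  adj : ∀ i, GridAdj (f i) (f (i + 1))

/-- The edge set of a grid cycle. -/
def GridCycle.edgeSet (C : GridCycle) : Set (Sym2 GridV) :=
  {e | ∃ i : ZMod C.n, e = s(C.f i, C.f (i + 1))}

/-- An edge set is (the edge set of) a cycle of the grid graph `G`.
We identify a cycle with its edge set. -/
def IsCycle (E : Set (Sym2 GridV)) : Prop := ∃ C : GridCycle, C.edgeSet = E

/-- A cycle of the subgraph of the grid graph with edge set `G`. -/
def IsCycleIn (G E : Set (Sym2 GridV)) : Prop := IsCycle E ∧ E ⊆ G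

/-- The vertices incident to some edge of `E`. -/
def vertexSetOf (E : Set (Sym2 GridV)) : Set GridV := {v | ∃ e ∈ E, v ∈ e}

/-- The closed segment in the plane realizing an edge. -/
noncomputable def edgeSeg : Sym2 GridV → Set (ℝ × ℝ) :=
  Sym2.lift ⟨fun a b => segment ℝ (toPlane a) (toPlane b), fun _ _ => segment_symm ℝ _ _⟩

/-- The closed curve in the plane traced by the edges of `E`. -/
noncomputable def carrierOf (E : Set (Sym2 GridV)) : Set (ℝ × ℝ) := ⋃ e ∈ E, edgeSeg e

/-- The interior of a cycle: the union of the bounded connected components of the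
complement of its carrier curve. -/
noncomputable def interiorOf (E : Set (Sym2 GridV)) : Set (ℝ × ℝ) :=
  {p | p ∉ carrierOf E ∧ Bornology.IsBounded (connectedComponentIn (carrierOf E)ᶜ p)}

/-- The exterior of a cycle: the union of the unbounded connected components of the
complement of its carrier curve. -/
noncomputable def exteriorOf (E : Set (Sym2 GridV)) : Set (ℝ × ℝ) :=
  {p | p ∉ carrierOf E ∧ ¬ Bornology.IsBounded (connectedComponentIn (carrierOf E)ᶜ p)}

/-- The set `A` is contained in the interior of the cycle `E` (points of the
curve itself being allowed, so that e.g. a square whose boundary edges lie on the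
cycle counts as contained in the interior). -/
def inInterior (E : Set (Sym2 GridV)) (A : Set (ℝ × ℝ)) : Prop :=
  A ⊆ interiorOf E ∪ carrierOf E

/-- The set `A` lies in the exterior of the cycle `E` (points of the curve itself
being allowed). -/
def inExterior (E : Set (Sym2 GridV)) (A : Set (ℝ × ℝ)) : Prop :=
  A ⊆ exteriorOf E ∪ carrierOf E

/-- Star adjacency: distinct squares sharing at least a corner. -/
def starAdj (z w : GridV) : Prop := z ≠ w ∧ |z.1 - w.1| ≤ 1 ∧ |z.2 - w.2| ≤ 1

/-- Plus adjacency: squares sharing an edge. -/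
def plusAdj (z w : GridV) : Prop := |z.1 - w.1| + |z.2 - w.2| = 1

/-- The star-connected occupied component `C(0)` of the square `S₀` (of index `(0,0)`),
for the occupancy configuration `ω`; empty if `S₀` is vacant. -/
def starComp (ω : GridV → Prop) : Set GridV :=
  {z | ω z ∧ Relation.ReflTransGen (fun a b => ω a ∧ ω b ∧ starAdj a b) (0, 0) z}

/-- The plus-connected occupied component `C⁺(0)` of the square `S₀`. -/
def plusComp (ω : GridV → Prop) : Set GridV :=
  {z | ω z ∧ Relation.ReflTransGen (fun a b => ω a ∧ ω b ∧ plusAdj a b) (0, 0) z}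

/-- The edge set of the graph `G_C`: all edges of squares of `C(0)`. -/
def gcEdges (ω : GridV → Prop) : Set (Sym2 GridV) := ⋃ z ∈ starComp ω, squareEdges z

/-- The edge set of the graph `G⁺_C`: all edges of squares of `C⁺(0)`. -/
def gpcEdges (ω : GridV → Prop) : Set (Sym2 GridV) := ⋃ z ∈ plusComp ω, squareEdges z

/-- `e` is an outermost boundary edge of the graph with edge set `G`: for every
cycle `E` in this graph, either `e` is an edge of `E` or `e` lies in the exterior of `E`. -/
def outermostBoundaryEdgeIn (G : Set (Sym2 GridV)) (e : Sym2 GridV) : Prop :=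
  e ∈ G ∧ ∀ E, IsCycleIn G E → e ∈ E ∨ inExterior E (edgeSeg e)

/-- The subgraph spanned by the edge set `E` is connected: any two incident vertices
are joined by a walk using only edges of `E`. -/
def EdgeSetConnected (E : Set (Sym2 GridV)) : Prop :=
  ∀ u v, u ∈ vertexSetOf E → v ∈ vertexSetOf E →
    ∃ p : List GridV, p.head? = some u ∧ p.getLast? = some v ∧
      List.Chain' (fun a b => s(a, b) ∈ E) p

/-- `D` is the outermost boundary cycle `D_k` of the square of index `z` of the star
component `C(0)`: (a) the square lies in the interior of `D`; (b) every edge of `D` is a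
boundary edge adjacent to an occupied square of `C(0)` in the interior of `D` and to a
vacant square in the exterior of `D`; (c) every cycle of `G_C` containing the square in
its interior has all its edges on `D` or in the interior of `D`. -/
def isOutermostCycleOf (ω : GridV → Prop) (z : GridV) (D : Set (Sym2 GridV)) : Prop :=
  IsCycleIn (gcEdges ω) D ∧
  inInterior D (squareSet z) ∧
  (∀ e ∈ D,
    (∃ w ∈ starComp ω, e ∈ squareEdges w ∧ inInterior D (squareSet w)) ∧
    (∃ w, ¬ ω w ∧ e ∈ squareEdges w ∧ inExterior D (squareSet w))) ∧
  (∀ C, IsCycleIn (gcEdges ω) C → inInterior C (squareSet z) →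
    ∀ e ∈ C, e ∈ D ∨ inInterior D (edgeSeg e))

/-- The list of edges traversed by a walk given as a list of vertices. -/
def walkEdges (p : List GridV) : List (Sym2 GridV) :=
  List.zipWith (fun a b => s(a, b)) p p.tail

/-- The horizontal edge with left endpoint `(x, y)`. -/
def horEdge (x y : ℤ) : Sym2 GridV := s((x, y), (x + 1, y))

/-- The vertical edge with lower endpoint `(x, y)`. -/
def vertEdge (x y : ℤ) : Sym2 GridV := s((x, y), (x, y + 1))

lemma horEdge_inj {x y x' y' : ℤ} : horEdge x y = horEdge x' y' ↔ x = x' ∧ y = y' := by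
  simp only [horEdge, Sym2.eq_iff, Prod.mk.injEq]
  omega

lemma vertEdge_inj {x y x' y' : ℤ} : vertEdge x y = vertEdge x' y' ↔ x = x' ∧ y = y' := by
  simp only [vertEdge, Sym2.eq_iff, Prod.mk.injEq]
  omega

lemma horEdge_ne_vertEdge (x y x' y' : ℤ) : horEdge x y ≠ vertEdge x' y' := by
  simp only [horEdge, vertEdge, Ne, Sym2.eq_iff, Prod.mk.injEq]
  omega

lemma abs_add_abs_eq_one_cases {a b : ℤ} (h : |a| + |b| = 1) :
    (a = 1 ∧ b = 0) ∨ (a = -1 ∧ b = 0) ∨ (a = 0 ∧ b = 1) ∨ (a = 0 ∧ b = -1) := by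
  rcases abs_cases a with ⟨h1, _⟩ | ⟨h1, _⟩ <;> rcases abs_cases b with ⟨h2, _⟩ | ⟨h2, _⟩ <;>
    omega

lemma gridAdj_cases {a b : GridV} (h : GridAdj a b) :
    (∃ x y, s(a, b) = horEdge x y) ∨ ∃ x y, s(a, b) = vertEdge x y := by
  obtain ⟨a1, a2⟩ := a
  obtain ⟨b1, b2⟩ := b
  simp only [GridAdj] at h
  have : (a1 = b1 + 1 ∧ a2 = b2) ∨ (b1 = a1 + 1 ∧ a2 = b2) ∨ (a1 = b1 ∧ a2 = b2 + 1) ∨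
      (a1 = b1 ∧ b2 = a2 + 1) := by
    have := abs_add_abs_eq_one_cases h
    omega
  rcases this with ⟨rfl, rfl⟩ | ⟨rfl, rfl⟩ | ⟨rfl, rfl⟩ | ⟨rfl, rfl⟩
  · exact Or.inl ⟨b1, a2, Sym2.eq_swap⟩
  · exact Or.inl ⟨a1, a2, rfl⟩
  · exact Or.inr ⟨a1, b2, Sym2.eq_swap⟩
  · exact Or.inr ⟨a1, a2, rfl⟩

lemma horEdge_mem_squareEdges {x y : ℤ} {w : GridV} :
    horEdge x y ∈ squareEdges w ↔ w = (x, y) ∨ w = (x, y - 1) := by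
  obtain ⟨a, b⟩ := w
  simp only [horEdge, squareEdges, Set.mem_insert_iff, Set.mem_singleton_iff, Sym2.eq_iff,
    Prod.mk.injEq, Prod.mk_add_mk]
  omega

lemma vertEdge_mem_squareEdges {x y : ℤ} {w : GridV} :
    vertEdge x y ∈ squareEdges w ↔ w = (x, y) ∨ w = (x - 1, y) := by
  obtain ⟨a, b⟩ := w
  simp only [vertEdge, squareEdges, Set.mem_insert_iff, Set.mem_singleton_iff, Sym2.eq_iff,
    Prod.mk.injEq, Prod.mk_add_mk]
  omega

lemma squareEdges_cases {e : Sym2 GridV} {w : GridV} (h : e ∈ squareEdges w) :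
    (∃ x y, e = horEdge x y) ∨ ∃ x y, e = vertEdge x y := by
  simp only [squareEdges, Set.mem_insert_iff, Set.mem_singleton_iff] at h
  rcases h with rfl | rfl | rfl | rfl <;> refine gridAdj_cases ?_ <;> simp [GridAdj]

/-- The edges separating a square in `S` from a square outside `S`. -/
def edgeBoundary (S : Set GridV) : Set (Sym2 GridV) :=
  {e | ∃ w ∈ S, ∃ w' ∉ S, e ∈ squareEdges w ∧ e ∈ squareEdges w'}

lemma horEdge_mem_edgeBoundary {S : Set GridV} {x y : ℤ} :
    horEdge x y ∈ edgeBoundary S ↔ ¬((x, y) ∈ S ↔ (x, y - 1) ∈ S) := by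
  simp only [edgeBoundary, Set.mem_ofPred_eq, horEdge_mem_squareEdges]
  constructor
  · rintro ⟨w, hw, w', hw', rfl | rfl, rfl | rfl⟩ <;> tauto
  · intro h
    by_cases h1 : (x, y) ∈ S
    · exact ⟨_, h1, (x, y - 1), by tauto, by simp⟩
    · exact ⟨(x, y - 1), by tauto, _, h1, by simp⟩

lemma vertEdge_mem_edgeBoundary {S : Set GridV} {x y : ℤ} :
    vertEdge x y ∈ edgeBoundary S ↔ ¬((x, y) ∈ S ↔ (x - 1, y) ∈ S) := by
  simp only [edgeBoundary, Set.mem_ofPred_eq, vertEdge_mem_squareEdges]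
  constructor
  · rintro ⟨w, hw, w', hw', rfl | rfl, rfl | rfl⟩ <;> tauto
  · intro h
    by_cases h1 : (x, y) ∈ S
    · exact ⟨_, h1, (x - 1, y), by tauto, by simp⟩
    · exact ⟨(x - 1, y), by tauto, _, h1, by simp⟩

lemma edgeBoundary_cases {S : Set GridV} {e : Sym2 GridV} (h : e ∈ edgeBoundary S) :
    (∃ x y, e = horEdge x y) ∨ ∃ x y, e = vertEdge x y :=
  let ⟨_, _, _, _, h, _⟩ := h
  squareEdges_cases h

lemma plusAdj_comm {a b : GridV} : plusAdj a b ↔ plusAdj b a := by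
  simp only [plusAdj, abs_sub_comm]

lemma plusAdj_of_mem_squareEdges {e : Sym2 GridV} {w w' : GridV} (h : e ∈ squareEdges w)
    (h' : e ∈ squareEdges w') (hne : w ≠ w') : plusAdj w w' := by
  rcases squareEdges_cases h with ⟨x, y, rfl⟩ | ⟨x, y, rfl⟩
  · rw [horEdge_mem_squareEdges] at h h'
    rcases h with rfl | rfl <;> rcases h' with rfl | rfl <;> simp_all [plusAdj]
  · rw [vertEdge_mem_squareEdges] at h h'
    rcases h with rfl | rfl <;> rcases h' with rfl | rfl <;> simp_all [plusAdj]

lemma exists_mem_squareEdges_of_plusAdj {w w' : GridV} (h : plusAdj w w') :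
    ∃ e, e ∈ squareEdges w ∧ e ∈ squareEdges w' := by
  obtain ⟨a, b⟩ := w
  obtain ⟨a', b'⟩ := w'
  simp only [plusAdj] at h
  have : (a = a' + 1 ∧ b = b') ∨ (a' = a + 1 ∧ b = b') ∨ (a = a' ∧ b = b' + 1) ∨
      (a = a' ∧ b' = b + 1) := by
    have := abs_add_abs_eq_one_cases h
    omega
  rcases this with ⟨rfl, rfl⟩ | ⟨rfl, rfl⟩ | ⟨rfl, rfl⟩ | ⟨rfl, rfl⟩
  · exact ⟨vertEdge (a' + 1) b, by simp [vertEdge_mem_squareEdges]⟩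
  · exact ⟨vertEdge (a + 1) b, by simp [vertEdge_mem_squareEdges]⟩
  · exact ⟨horEdge a (b' + 1), by simp [horEdge_mem_squareEdges]⟩
  · exact ⟨horEdge a (b + 1), by simp [horEdge_mem_squareEdges]⟩

/-- An edge belongs to at most two squares. -/
lemma eq_or_eq_of_mem_squareEdges {e : Sym2 GridV} {w w' t : GridV} (h : e ∈ squareEdges w)
    (h' : e ∈ squareEdges w') (hne : w ≠ w') (ht : e ∈ squareEdges t) : t = w ∨ t = w' := by
  rcases squareEdges_cases h with ⟨x, y, rfl⟩ | ⟨x, y, rfl⟩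
  · rw [horEdge_mem_squareEdges] at h h' ht
    grind
  · rw [vertEdge_mem_squareEdges] at h h' ht
    grind

lemma finite_squareEdges (w : GridV) : (squareEdges w).Finite := by
  simp [squareEdges]

lemma finite_edgeBoundary {S : Set GridV} (hS : S.Finite) : (edgeBoundary S).Finite :=
  (hS.biUnion fun w _ ↦ finite_squareEdges w).subset fun _ ⟨_, hw, _, _, h, _⟩ =>
    Set.mem_biUnion hw h

/-! ### Mod 2 chains and potentials -/

/-- The mod 2 degree at a corner of a mod 2 chain of edges. -/
def chainDeg (F : Sym2 GridV → ZMod 2) (u : GridV) : ZMod 2 :=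
  F (horEdge u.1 u.2) + F (horEdge (u.1 - 1) u.2) + F (vertEdge u.1 u.2) +
    F (vertEdge u.1 (u.2 - 1))

/-- The chain `F` is the coboundary of the function `p` on squares. -/
def IsPotential (F : Sym2 GridV → ZMod 2) (p : GridV → ZMod 2) : Prop :=
  ∀ x y, F (horEdge x y) = p (x, y) + p (x, y - 1) ∧ F (vertEdge x y) = p (x, y) + p (x - 1, y)

lemma chainDeg_add (F G : Sym2 GridV → ZMod 2) (u : GridV) :
    chainDeg (F + G) u = chainDeg F u + chainDeg G u := by
  simp only [chainDeg, Pi.add_apply]; ring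

lemma chainDeg_smul (c : ZMod 2) (F : Sym2 GridV → ZMod 2) (u : GridV) :
    chainDeg (c • F) u = c * chainDeg F u := by
  simp only [chainDeg, Pi.smul_apply, smul_eq_mul]; ring

lemma chainDeg_sum {ι : Type*} (s : Finset ι) (F : ι → Sym2 GridV → ZMod 2) (u : GridV) :
    chainDeg (∑ i ∈ s, F i) u = ∑ i ∈ s, chainDeg (F i) u := by
  simp only [chainDeg, Finset.sum_apply, Finset.sum_add_distrib]

lemma chainDeg_single {a b : GridV} (h : GridAdj a b) (u : GridV) :
    chainDeg (Pi.single s(a, b) 1) u = (if u = a then 1 else 0) + (if u = b then 1 else 0) := by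
  have hor (x y : ℤ) : chainDeg (Pi.single (horEdge x y) 1) u =
      (if u = (x, y) then 1 else 0) + (if u = (x + 1, y) then 1 else 0) := by
    simp only [chainDeg, Pi.single_apply, horEdge_inj, (horEdge_ne_vertEdge _ _ _ _).symm,
      Prod.ext_iff, if_false, sub_eq_iff_eq_add, add_zero]
  have vert (x y : ℤ) : chainDeg (Pi.single (vertEdge x y) 1) u =
      (if u = (x, y) then 1 else 0) + (if u = (x, y + 1) then 1 else 0) := by
    simp only [chainDeg, Pi.single_apply, vertEdge_inj, horEdge_ne_vertEdge,
      Prod.ext_iff, if_false, sub_eq_iff_eq_add, zero_add]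
  obtain ⟨a1, a2⟩ := a
  obtain ⟨b1, b2⟩ := b
  simp only [GridAdj] at h
  have : (a1 = b1 + 1 ∧ a2 = b2) ∨ (b1 = a1 + 1 ∧ a2 = b2) ∨ (a1 = b1 ∧ a2 = b2 + 1) ∨
      (a1 = b1 ∧ b2 = a2 + 1) := by
    have := abs_add_abs_eq_one_cases h
    omega
  rcases this with ⟨rfl, rfl⟩ | ⟨rfl, rfl⟩ | ⟨rfl, rfl⟩ | ⟨rfl, rfl⟩
  · rw [Sym2.eq_swap]; exact (hor b1 a2).trans (add_comm _ _)
  · exact hor a1 a2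
  · rw [Sym2.eq_swap]; exact (vert a1 b2).trans (add_comm _ _)
  · exact vert a1 a2

lemma IsPotential.chainDeg_eq_zero {F : Sym2 GridV → ZMod 2} {p : GridV → ZMod 2}
    (h : IsPotential F p) (u : GridV) : chainDeg F u = 0 := by
  simp only [chainDeg, (h _ _).1, (h _ _).2]
  generalize p (u.1, u.2) = a
  generalize p (u.1, u.2 - 1) = b
  generalize p (u.1 - 1, u.2) = c
  generalize p (u.1 - 1, u.2 - 1) = d
  revert a b c d
  decide

lemma exists_bound {F : Sym2 GridV → ZMod 2} (hF : (Function.support F).Finite) :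
    ∃ N : ℤ, ∀ x y, (F (horEdge x y) ≠ 0 → |x| < N ∧ |y| < N) ∧
      (F (vertEdge x y) ≠ 0 → |x| < N ∧ |y| < N) := by
  have key (g : ℤ × ℤ → Sym2 GridV) (hg : Function.Injective g) :
      ∃ N : ℤ, ∀ x y, F (g (x, y)) ≠ 0 → |x| < N ∧ |y| < N := by
    have hfin : {u : ℤ × ℤ | F (g u) ≠ 0}.Finite := hF.preimage hg.injOn
    obtain ⟨N, hN⟩ := (hfin.image fun u => |u.1| + |u.2|).bddAbove
    refine ⟨N + 1, fun x y h => ?_⟩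
    have := hN (Set.mem_image_of_mem _ (show (x, y) ∈ {u : ℤ × ℤ | F (g u) ≠ 0} from h))
    have := abs_nonneg x
    have := abs_nonneg y
    constructor <;> simp only at * <;> omega
  obtain ⟨N, hN⟩ := key (fun u => horEdge u.1 u.2) fun u v h => by
    simpa [Prod.ext_iff] using horEdge_inj.1 h
  obtain ⟨M, hM⟩ := key (fun u => vertEdge u.1 u.2) fun u v h => by
    simpa [Prod.ext_iff] using vertEdge_inj.1 h
  refine ⟨max N M, fun x y => ⟨fun h => ?_, fun h => ?_⟩⟩
  · have := hN x y h; omega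
  · have := hM x y h; omega

/-- A finite even chain of edges is the coboundary of a finitely supported function. -/
lemma exists_potential {F : Sym2 GridV → ZMod 2} (hF : (Function.support F).Finite)
    (hdeg : ∀ u, chainDeg F u = 0) :
    ∃ p, (Function.support p).Finite ∧ IsPotential F p := by
  obtain ⟨N, hN⟩ := exists_bound hF
  have hh (x y) (h : ¬(|x| < N ∧ |y| < N)) : F (horEdge x y) = 0 := by
    by_contra h'; exact h ((hN x y).1 h')
  have hv (x y) (h : ¬(|x| < N ∧ |y| < N)) : F (vertEdge x y) = 0 := by
    by_contra h'; exact h ((hN x y).2 h')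
  let p : GridV → ZMod 2 := fun w => ∑ k ∈ Finset.Ioc w.1 N, F (vertEdge k w.2)
  have hpN (x y) (hx : N ≤ x) : p (x, y) = 0 := by
    simp [p, Finset.Ioc_eq_empty_of_le hx]
  have hstep (x y) : p (x - 1, y) = F (vertEdge x y) + p (x, y) := by
    by_cases hx : x ≤ N
    · have : Finset.Ioc (x - 1) N = insert x (Finset.Ioc x N) := by
        ext k; simp only [Finset.mem_Ioc, Finset.mem_insert]; omega
      simp only [p, this]
      rw [Finset.sum_insert (by simp)]
    · rw [hpN _ _ (by omega), hpN _ _ (by omega), hv]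
      · simp
      · have := le_abs_self x; omega
  have c2 (a b c : ZMod 2) (h : a = b + c) : b = c + a := by revert a b c; decide
  have hpotv (x y) : F (vertEdge x y) = p (x, y) + p (x - 1, y) := c2 _ _ _ (hstep x y)
  have hpoth (x y) : F (horEdge x y) = p (x, y) + p (x, y - 1) := by
    rcases le_total N x with hx | hx
    · rw [hpN _ _ hx, hpN _ _ hx, hh]
      · simp
      · have := le_abs_self x; omega
    · induction x, hx using Int.leInductionDown with
      | base =>
        rw [hpN _ _ le_rfl, hpN _ _ le_rfl, hh]
        · simp
        · have := le_abs_self N; omega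
      | pred x hx ih =>
        have h := hdeg (x, y)
        simp only [chainDeg] at h
        rw [hstep, hstep]
        generalize F (vertEdge x y) = a at *
        generalize F (vertEdge x (y - 1)) = b at *
        generalize F (horEdge x y) = c at *
        generalize F (horEdge (x - 1) y) = d at *
        generalize p (x, y) = e at *
        generalize p (x, y - 1) = f at *
        clear * - h ih
        revert a b c d e f
        decide
  refine ⟨p, ?_, fun x y => ⟨hpoth x y, hpotv x y⟩⟩
  have hy0 (x y) (hy : N ≤ |y|) : p (x, y) = 0 :=
    Finset.sum_eq_zero fun k _ => hv _ _ (by dsimp only; omega)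
  have hx0 (x y) (hx : x < -N) : p (x, y) = 0 := by
    rcases le_total N y with hy | hy
    · exact hy0 _ _ (hy.trans (le_abs_self y))
    · induction y, hy using Int.leInductionDown with
      | base => exact hy0 _ _ (le_abs_self N)
      | pred y hy ih =>
        have := hpoth x y
        rw [ih, hh x y (by have := neg_abs_le x; omega)] at this
        simpa using this.symm
  refine ((Set.finite_Icc (-N, -N) (N, N))).subset fun ⟨x, y⟩ h => ?_
  simp only [Function.mem_support] at h
  have h1 : ¬ x < -N := fun h' => h (hx0 _ _ h')
  have h2 : ¬ N ≤ x := fun h' => h (hpN _ _ h')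
  have h3 : ¬ N ≤ |y| := fun h' => h (hy0 _ _ h')
  simp only [Set.mem_Icc, Prod.mk_le_mk]
  have := abs_lt.1 (not_le.1 h3)
  omega

/-- Going right from a square of a finite set, one eventually leaves this set. -/
lemma exists_leaving_right {S : Set GridV} (hS : S.Finite) {x y : ℤ} (h : (x, y) ∈ S) :
    ∃ x', x ≤ x' ∧ (∀ k, x ≤ k → k ≤ x' → (k, y) ∈ S) ∧ (x' + 1, y) ∉ S := by
  by_contra! hcon
  have hall : ∀ n : ℕ, ∀ k, x ≤ k → k ≤ x + n → (k, y) ∈ S := by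
    intro n
    induction n with
    | zero => intro k h1 h2; obtain rfl : k = x := by omega
              exact h
    | succ n ih =>
      intro k h1 h2
      rcases lt_or_eq_of_le h2 with h2 | rfl
      · exact ih k h1 (by push_cast at h2; omega)
      · have := hcon (x + n) (by omega) ih
        push_cast
        rwa [← add_assoc]
  refine Set.infinite_of_injective_forall_mem (f := fun n : ℕ => (x + n, y)) ?_
    (fun n => hall n _ (by omega) le_rfl) hS
  intro a b hab
  simpa using hab

/-- Going left from a square of a finite set, one eventually leaves this set. -/
lemma exists_leaving_left {S : Set GridV} (hS : S.Finite) {x y : ℤ} (h : (x, y) ∈ S) :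
    ∃ x', x' ≤ x ∧ (∀ k, x' ≤ k → k ≤ x → (k, y) ∈ S) ∧ (x' - 1, y) ∉ S := by
  have hT : ((fun w : GridV => (-w.1, w.2)) ⁻¹' S).Finite :=
    hS.preimage fun a _ b _ hab => by simpa [Prod.ext_iff] using hab
  obtain ⟨x', h1, h2, h3⟩ := exists_leaving_right (x := -x) (y := y) hT (by simpa using h)
  refine ⟨-x', by omega, fun k hk hk' => ?_, ?_⟩
  · simpa using h2 (-k) (by omega) (by omega)
  · simpa [sub_eq_add_neg, add_comm] using h3

lemma IsPotential.unique {F : Sym2 GridV → ZMod 2} {p q : GridV → ZMod 2}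
    (hp : IsPotential F p) (hq : IsPotential F q) (hpf : (Function.support p).Finite)
    (hqf : (Function.support q).Finite) : p = q := by
  by_contra hne
  obtain ⟨⟨x, y⟩, hw⟩ := Function.ne_iff.1 hne
  have hfin : {w | p w ≠ q w}.Finite := (hpf.union hqf).subset fun w hw => by
    by_contra h
    simp only [Set.mem_union, Function.mem_support, not_or, not_not] at h
    exact hw (h.1.trans h.2.symm)
  obtain ⟨x', hx, h2, h3⟩ := exists_leaving_right hfin hw
  have h1 := (hp (x' + 1) y).2.symm.trans (hq (x' + 1) y).2
  rw [show p (x' + 1, y) = q (x' + 1, y) from not_not.1 h3, add_sub_cancel_right] at h1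
  exact h2 x' hx le_rfl (add_left_cancel h1)

lemma exists_mem_edgeBoundary {S : Set GridV} (hS : S.Finite) (hne : S.Nonempty) :
    (edgeBoundary S).Nonempty := by
  obtain ⟨⟨x, y⟩, h⟩ := hne
  obtain ⟨x', hx, h2, h3⟩ := exists_leaving_right hS h
  refine ⟨vertEdge (x' + 1) y, vertEdge_mem_edgeBoundary.2 ?_⟩
  have := h2 x' hx le_rfl
  simp_all

/-- The mod 2 indicator of the edge boundary of `S` is the coboundary of the indicator of `S`. -/
lemma isPotential_indicator (S : Set GridV) :
    IsPotential ((edgeBoundary S).indicator 1) (S.indicator 1) := by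
  classical
  intro x y
  simp only [Set.indicator_apply, horEdge_mem_edgeBoundary, vertEdge_mem_edgeBoundary,
    Pi.one_apply]
  constructor <;> split_ifs <;> first | rfl | (exfalso; tauto)

/-! ### Cycles of the grid -/

namespace GridCycle

variable (C : GridCycle)

instance : NeZero C.n := ⟨by have := C.hn; omega⟩

/-- The `i`-th edge of a grid cycle. -/
def edge (i : ZMod C.n) : Sym2 GridV := s(C.f i, C.f (i + 1))

lemma edge_mem (i : ZMod C.n) : C.edge i ∈ C.edgeSet := ⟨i, rfl⟩

lemma edge_injective : Function.Injective C.edge := by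
  intro i j h
  simp only [edge, Sym2.eq_iff, C.inj.eq_iff] at h
  rcases h with h | ⟨h1, h2⟩
  · exact h.1
  · exfalso
    have h3 : ((2 : ℕ) : ZMod C.n) = 0 := by
      push_cast
      linear_combination h2 - h1
    rw [ZMod.natCast_eq_zero_iff] at h3
    have := Nat.le_of_dvd (by norm_num) h3
    have := C.hn
    omega

lemma eq_sum_single {F : Sym2 GridV → ZMod 2} (hF : Function.support F ⊆ C.edgeSet) :
    F = ∑ i, F (C.edge i) • Pi.single (C.edge i) (1 : ZMod 2) := by
  ext e
  simp only [Finset.sum_apply, Pi.smul_apply, Pi.single_apply, smul_eq_mul, mul_ite, mul_one,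
    mul_zero]
  by_cases he : e ∈ C.edgeSet
  · obtain ⟨j, rfl⟩ := he
    change F (C.edge j) = ∑ i, if C.edge j = C.edge i then F (C.edge i) else 0
    simp [C.edge_injective.eq_iff]
  · rw [Finset.sum_eq_zero]
    · by_contra h; exact he (hF h)
    · rintro i -
      rw [if_neg]
      rintro rfl
      exact he (C.edge_mem i)

lemma chainDeg_eq {F : Sym2 GridV → ZMod 2} (hF : Function.support F ⊆ C.edgeSet) (u : GridV) :
    chainDeg F u = ∑ i, F (C.edge i) *
      ((if u = C.f i then 1 else 0) + (if u = C.f (i + 1) then 1 else 0)) := by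
  conv_lhs => rw [C.eq_sum_single hF]
  rw [chainDeg_sum]
  exact Finset.sum_congr rfl fun i _ => by rw [chainDeg_smul, edge, chainDeg_single (C.adj i)]

/-- An even chain supported on a cycle is constant on this cycle. -/
lemma const_of_chainDeg_eq_zero {F : Sym2 GridV → ZMod 2} (hF : Function.support F ⊆ C.edgeSet)
    (hdeg : ∀ u, chainDeg F u = 0) (i : ZMod C.n) : F (C.edge i) = F (C.edge 0) := by
  have hstep (j : ZMod C.n) : F (C.edge (j + 1)) = F (C.edge j) := by
    have h := hdeg (C.f (j + 1))
    rw [C.chainDeg_eq hF] at h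
    simp only [C.inj.eq_iff, mul_add, mul_ite, mul_one, mul_zero, Finset.sum_add_distrib,
      Finset.sum_ite_eq, Finset.mem_univ, if_true, add_left_inj] at h
    exact CharTwo.add_eq_zero.1 h
  have hnat (k : ℕ) : F (C.edge k) = F (C.edge 0) := by
    induction k with
    | zero => simp
    | succ k ih => rw [Nat.cast_succ, hstep, ih]
  simpa using hnat i.val

lemma chainDeg_indicator (u : GridV) : chainDeg (C.edgeSet.indicator 1) u = 0 := by
  rw [C.chainDeg_eq (by simp)]
  simp only [Set.indicator_of_mem (C.edge_mem _), Pi.one_apply, one_mul, Finset.sum_add_distrib]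
  have := Equiv.sum_comp (Equiv.addRight (1 : ZMod C.n)) fun i =>
    if u = C.f i then (1 : ZMod 2) else 0
  simp only [Equiv.coe_addRight] at this
  refine (congrArg (_ + ·) this).trans ?_
  exact CharTwo.add_self_eq_zero _

lemma exists_arc (i j : ZMod C.n) : ∃ F : Sym2 GridV → ZMod 2, Function.support F ⊆ C.edgeSet ∧
    ∀ u, chainDeg F u = (if u = C.f i then 1 else 0) + (if u = C.f j then 1 else 0) := by
  have hnat (k : ℕ) : ∃ F : Sym2 GridV → ZMod 2, Function.support F ⊆ C.edgeSet ∧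
      ∀ u, chainDeg F u = (if u = C.f i then 1 else 0) + (if u = C.f (i + k) then 1 else 0) := by
    induction k with
    | zero => exact ⟨0, by simp, fun u => by simp [chainDeg, CharTwo.add_self_eq_zero]⟩
    | succ k ih =>
      obtain ⟨F, hF, hdeg⟩ := ih
      refine ⟨F + Pi.single (C.edge (i + k)) 1, ?_, fun u => ?_⟩
      · refine (Function.support_add _ _).trans (Set.union_subset hF ?_)
        refine (Pi.support_single_subset).trans ?_
        simpa using C.edge_mem _
      · rw [chainDeg_add, hdeg, edge, chainDeg_single (C.adj _), Nat.cast_succ, ← add_assoc i]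
        generalize (if u = C.f i then (1 : ZMod 2) else 0) = a
        generalize (if u = C.f (i + k) then (1 : ZMod 2) else 0) = b
        generalize (if u = C.f (i + k + 1) then (1 : ZMod 2) else 0) = c
        revert a b c
        decide
  simpa using hnat (j - i).val

lemma finite_edgeSet : C.edgeSet.Finite := by
  refine (Set.finite_range C.edge).subset ?_
  rintro e ⟨i, rfl⟩
  exact ⟨i, rfl⟩

lemma edgeSet_cases {e : Sym2 GridV} (h : e ∈ C.edgeSet) :
    (∃ x y, e = horEdge x y) ∨ ∃ x y, e = vertEdge x y := by
  obtain ⟨i, rfl⟩ := h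
  exact gridAdj_cases (C.adj i)

lemma exists_index {a : GridV} (h : a ∈ vertexSetOf C.edgeSet) : ∃ i, C.f i = a := by
  obtain ⟨e, ⟨i, rfl⟩, ha⟩ := h
  rcases Sym2.mem_iff.1 ha with rfl | rfl <;> exact ⟨_, rfl⟩

end GridCycle

lemma eq_edgeBoundary_of_isPotential {E : Set (Sym2 GridV)}
    (hE : ∀ e ∈ E, (∃ x y, e = horEdge x y) ∨ ∃ x y, e = vertEdge x y) {p : GridV → ZMod 2}
    (hp : IsPotential (E.indicator 1) p) : edgeBoundary (Function.support p) = E := by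
  classical
  have key (e : Sym2 GridV) (a b : ZMod 2) (h : E.indicator 1 e = a + b) :
      ¬(a ≠ 0 ↔ b ≠ 0) ↔ e ∈ E := by
    by_cases he : e ∈ E
    · simp only [he, Set.indicator_of_mem, Pi.one_apply, iff_true] at h ⊢
      revert a b; decide
    · simp only [he, Set.indicator_of_notMem, not_false_eq_true, iff_false] at h ⊢
      revert a b; decide
  ext e
  constructor
  · intro h
    rcases edgeBoundary_cases h with ⟨x, y, rfl⟩ | ⟨x, y, rfl⟩
    · exact (key _ _ _ (hp x y).1).1 (horEdge_mem_edgeBoundary.1 h)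
    · exact (key _ _ _ (hp x y).2).1 (vertEdge_mem_edgeBoundary.1 h)
  · intro h
    rcases hE e h with ⟨x, y, rfl⟩ | ⟨x, y, rfl⟩
    · exact horEdge_mem_edgeBoundary.2 ((key _ _ _ (hp x y).1).2 h)
    · exact vertEdge_mem_edgeBoundary.2 ((key _ _ _ (hp x y).2).2 h)

/-- A cycle is the edge boundary of a finite set of squares. -/
lemma IsCycle.exists_edgeBoundary_eq {E : Set (Sym2 GridV)} (hE : IsCycle E) :
    ∃ S : Set GridV, S.Finite ∧ edgeBoundary S = E := by
  obtain ⟨C, rfl⟩ := hE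
  obtain ⟨p, hp, hpot⟩ := exists_potential (F := C.edgeSet.indicator 1)
    (C.finite_edgeSet.subset (by simp)) C.chainDeg_indicator
  exact ⟨_, hp, eq_edgeBoundary_of_isPotential (fun e => C.edgeSet_cases) hpot⟩

lemma IsCycle.nonempty {E : Set (Sym2 GridV)} (hE : IsCycle E) : E.Nonempty := by
  obtain ⟨C, rfl⟩ := hE
  exact ⟨_, C.edge_mem 0⟩

lemma eq_empty_of_edgeBoundary_eq_empty {S : Set GridV} (hS : S.Finite)
    (h : edgeBoundary S = ∅) : S = ∅ := by
  by_contra hne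
  exact (exists_mem_edgeBoundary hS (Set.nonempty_iff_ne_empty.2 hne)).ne_empty h

lemma support_indicator_one_subset {α : Type*} (S : Set α) :
    Function.support (S.indicator (1 : α → ZMod 2)) ⊆ S := by simp

lemma eq_of_edgeBoundary_eq {S T : Set GridV} (hS : S.Finite) (hT : T.Finite)
    (h : edgeBoundary S = edgeBoundary T) : S = T := by
  have h1 := isPotential_indicator S
  have h2 := isPotential_indicator T
  rw [h] at h1
  have h3 := h1.unique h2 (hS.subset (support_indicator_one_subset S))
    (hT.subset (support_indicator_one_subset T))
  have h4 := congrArg Function.support h3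
  simpa using h4

/-- The only finite sets of squares whose edge boundary lies on a cycle are the empty set and the
set of squares enclosed by this cycle. -/
lemma IsCycle.eq_empty_or_eq {S T : Set GridV} (hcyc : IsCycle (edgeBoundary S)) (hS : S.Finite)
    (hT : T.Finite) (h : edgeBoundary T ⊆ edgeBoundary S) : T = ∅ ∨ T = S := by
  obtain ⟨C, hC⟩ := hcyc
  have hconst := C.const_of_chainDeg_eq_zero (F := (edgeBoundary T).indicator 1)
    (by rw [hC]; exact (support_indicator_one_subset _).trans h)
    (isPotential_indicator T).chainDeg_eq_zero
  by_cases h0 : C.edge 0 ∈ edgeBoundary T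
  · right
    refine eq_of_edgeBoundary_eq hT hS (h.antisymm ?_)
    rw [← hC]
    rintro e ⟨i, rfl⟩
    by_contra hi
    have := hconst i
    rw [Set.indicator_of_mem h0, GridCycle.edge, Set.indicator_of_notMem hi] at this
    simp at this
  · left
    refine eq_empty_of_edgeBoundary_eq_empty hT (Set.eq_empty_iff_forall_notMem.2 fun e he => ?_)
    obtain ⟨i, rfl⟩ := hC ▸ h he
    have := hconst i
    rw [Set.indicator_of_notMem h0] at this
    simp only [GridCycle.edge, Set.indicator_of_mem he] at this
    simp at this

/-- Two corners of a cycle are joined by an arc of the cycle. -/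
lemma IsCycle.exists_arc {E : Set (Sym2 GridV)} (hE : IsCycle E) {a b : GridV}
    (ha : a ∈ vertexSetOf E) (hb : b ∈ vertexSetOf E) :
    ∃ F : Sym2 GridV → ZMod 2, Function.support F ⊆ E ∧
      ∀ u, chainDeg F u = (if u = a then 1 else 0) + (if u = b then 1 else 0) := by
  obtain ⟨C, rfl⟩ := hE
  obtain ⟨i, rfl⟩ := C.exists_index ha
  obtain ⟨j, rfl⟩ := C.exists_index hb
  exact C.exists_arc i j

lemma IsCycle.exists_mem_vertexSetOf_ne {E : Set (Sym2 GridV)} (hE : IsCycle E) (a : GridV) :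
    ∃ b ∈ vertexSetOf E, b ≠ a := by
  obtain ⟨C, rfl⟩ := hE
  by_contra! h
  have h1 := h (C.f 0) ⟨_, C.edge_mem 0, Sym2.mem_mk_left _ _⟩
  have h2 := h (C.f (0 + 1)) ⟨_, C.edge_mem 0, Sym2.mem_mk_right _ _⟩
  have := C.adj 0
  rw [h1, h2] at this
  simp [GridAdj] at this

/-- A nonempty finite even set of grid edges contains a cycle. -/
lemma exists_isCycle_subset {E : Set (Sym2 GridV)} (hfin : E.Finite) (hne : E.Nonempty)
    (hE : ∀ e ∈ E, (∃ x y, e = horEdge x y) ∨ ∃ x y, e = vertEdge x y)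
    (hdeg : ∀ u, chainDeg (E.indicator 1) u = 0) : ∃ D, IsCycle D ∧ D ⊆ E := by
  classical
  have hgrid {a b : GridV} (h : s(a, b) ∈ E) : GridAdj a b := by
    rcases hE _ h with ⟨x, y, h⟩ | ⟨x, y, h⟩
    · simp only [horEdge, Sym2.eq_iff] at h
      rcases h with ⟨rfl, rfl⟩ | ⟨rfl, rfl⟩ <;> simp [GridAdj]
    · simp only [vertEdge, Sym2.eq_iff] at h
      rcases h with ⟨rfl, rfl⟩ | ⟨rfl, rfl⟩ <;> simp [GridAdj]
  have hnext (a b : GridV) (h : s(a, b) ∈ E) : ∃ c, s(b, c) ∈ E ∧ c ≠ a := by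
    by_contra! hcon
    have hsupp : ∀ e ∈ E, b ∈ e → e = s(a, b) := by
      intro e he hb
      obtain ⟨c, rfl⟩ := hb
      rw [hcon c he, Sym2.eq_swap]
    have h0 :
        chainDeg (E.indicator 1 + Pi.single s(a, b) (1 : ZMod 2) : Sym2 GridV → ZMod 2) b = 0 := by
      have hz (e : Sym2 GridV) (hb : b ∈ e) :
          (E.indicator 1 + Pi.single s(a, b) (1 : ZMod 2) : Sym2 GridV → ZMod 2) e = 0 := by
        by_cases he : e ∈ E
        · rw [hsupp e he hb]
          simp [h, CharTwo.add_self_eq_zero]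
        · have : e ≠ s(a, b) := fun h' => he (h' ▸ h)
          simp [he, this]
      rw [chainDeg, hz, hz, hz, hz] <;> simp [horEdge, vertEdge]
    have hne : b ≠ a := by
      rintro rfl
      simpa [GridAdj] using hgrid h
    rw [chainDeg_add, hdeg, chainDeg_single (hgrid h)] at h0
    simp [hne] at h0
  choose! g hg hg' using hnext
  obtain ⟨e₀, he₀⟩ := hne
  induction e₀ with | _ a₀ b₀
  let d : ℕ → GridV × GridV := fun k => (fun p : GridV × GridV => (p.2, g p.1 p.2))^[k] (a₀, b₀)
  have hd (k) : d (k + 1) = ((d k).2, g (d k).1 (d k).2) := Function.iterate_succ_apply' _ _ _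
  let u : ℕ → GridV := fun k => (d k).1
  have hu (k) : d k = (u k, u (k + 1)) := by
    simp [u, hd]
  have hmem (k) : s(u k, u (k + 1)) ∈ E := by
    induction k with
    | zero => simpa [u, d] using he₀
    | succ k ih =>
      have : u (k + 2) = g (u k) (u (k + 1)) := by
        simp only [u, hd]
      rw [this]
      exact hg _ _ ih
  have hback (k) : u (k + 2) ≠ u k := by
    have : u (k + 2) = g (u k) (u (k + 1)) := by
      simp only [u, hd]
    rw [this]
    exact hg' _ _ (hmem k)
  have hrep : ∃ j, ∃ i < j, u i = u j := by
    have hVfin : {v | ∃ e ∈ E, v ∈ e}.Finite := by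
      have : {v | ∃ e ∈ E, v ∈ e} = ⋃ e ∈ E, {v | v ∈ e} := by ext; simp
      rw [this]
      refine hfin.biUnion fun e _ => ?_
      induction e with | _ a b
      exact (Set.toFinite {a, b}).subset fun v hv => by simpa using hv
    obtain ⟨i, -, j, -, hij, h⟩ := Set.infinite_univ.exists_ne_map_eq_of_mapsTo (f := u)
      (t := {v | ∃ e ∈ E, v ∈ e}) (fun k _ => ⟨_, hmem k, Sym2.mem_mk_left _ _⟩) hVfin
    rcases lt_or_gt_of_ne hij with hij | hij
    · exact ⟨j, i, hij, h⟩
    · exact ⟨i, j, hij, h.symm⟩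
  obtain ⟨i, hij, h⟩ := Nat.find_spec hrep
  have hmin {m} (hm : m < Nat.find hrep) := Nat.find_min hrep hm
  generalize Nat.find hrep = j at *
  push Not at hmin
  have hinj {k l} (hk : k < j) (hl : l < j) (hkl : u k = u l) : k = l := by
    rcases lt_trichotomy k l with h' | h' | h'
    · exact absurd hkl (hmin hl k h')
    · exact h'
    · exact absurd hkl.symm (hmin hk l h')
  have hne1 : j ≠ i + 1 := by
    rintro rfl
    have := hgrid (hmem i)
    rw [← h] at this
    simp [GridAdj] at this
  have hne2 : j ≠ i + 2 := by
    rintro rfl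
    exact hback i h.symm
  obtain ⟨n, rfl⟩ : ∃ n, j = i + (n + 1) := ⟨j - i - 1, by omega⟩
  have hwrap (t : ZMod (n + 1)) : u (i + (t + 1).val) = u (i + t.val + 1) := by
    have ht := t.val_lt
    have hn1 : (1 : ZMod (n + 1)).val = 1 := by
      have : Fact (1 < n + 1) := ⟨by omega⟩
      exact ZMod.val_one _
    rcases Nat.lt_or_ge (t.val + 1) (n + 1) with h' | h'
    · rw [ZMod.val_add_of_lt (by rw [hn1]; exact h'), hn1, add_assoc]
    · have h0 : t + 1 = 0 := by
        rw [← ZMod.val_eq_zero, ZMod.val_add, hn1, show t.val + 1 = n + 1 by omega, Nat.mod_self]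
      rw [h0, ZMod.val_zero, add_zero, h]
      congr 1
      omega
  refine ⟨_, ⟨⟨n + 1, by omega, fun t => u (i + t.val), fun s t hst => ?_, fun t => ?_⟩, rfl⟩, ?_⟩
  · have := s.val_lt
    have := t.val_lt
    exact ZMod.val_injective _ (by have := hinj (by omega) (by omega) hst; omega)
  · simp only [hwrap]
    exact hgrid (hmem _)
  · rintro e ⟨t, rfl⟩
    simp only [hwrap]
    exact hmem _

lemma edgeBoundary_compl (S : Set GridV) : edgeBoundary Sᶜ = edgeBoundary S := by
  ext e
  constructor
  · rintro ⟨w, hw, v, hv, hew, hev⟩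
    exact ⟨v, not_not.1 hv, w, hw, hev, hew⟩
  · rintro ⟨w, hw, v, hv, hew, hev⟩
    exact ⟨v, hv, w, not_not.2 hw, hev, hew⟩

/-! ### Plus-connected components of a set of squares -/

/-- The plus-connected component of the square `w` in the set of squares `T`. -/
def plusComponent (T : Set GridV) (w : GridV) : Set GridV :=
  {w' | Relation.ReflTransGen (fun a b => plusAdj a b ∧ b ∈ T) w w'}

section plusComponent

variable {T : Set GridV} {w : GridV}

lemma self_mem_plusComponent : w ∈ plusComponent T w := Relation.ReflTransGen.refl

lemma plusComponent_subset (hw : w ∈ T) : plusComponent T w ⊆ T := by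
  intro w' h
  cases h with
  | refl => exact hw
  | tail _ h => exact h.2

lemma mem_plusComponent_of_plusAdj {a b : GridV} (ha : a ∈ plusComponent T w) (h : plusAdj a b)
    (hb : b ∈ T) : b ∈ plusComponent T w :=
  Relation.ReflTransGen.tail ha ⟨h, hb⟩

lemma edgeBoundary_plusComponent_subset (hw : w ∈ T) :
    edgeBoundary (plusComponent T w) ⊆ edgeBoundary T := by
  rintro e ⟨a, ha, b, hb, hea, heb⟩
  refine ⟨a, plusComponent_subset hw ha, b, fun hbT => hb ?_, hea, heb⟩
  refine mem_plusComponent_of_plusAdj ha (plusAdj_of_mem_squareEdges hea heb ?_) hbT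
  rintro rfl
  exact hb ha

lemma plusComponent_induction {P : GridV → Prop} (h0 : P w)
    (hstep : ∀ a ∈ plusComponent T w, ∀ b ∈ plusComponent T w, plusAdj a b → P a → P b)
    {w' : GridV} (h : w' ∈ plusComponent T w) : P w' := by
  have : w' ∈ plusComponent T w ∧ P w' := by
    induction h with
    | refl => exact ⟨self_mem_plusComponent, h0⟩
    | tail _ hbc ih =>
      have := mem_plusComponent_of_plusAdj ih.1 hbc.1 hbc.2
      exact ⟨this, hstep _ ih.1 _ this hbc.1 ih.2⟩
  exact this.2

lemma plusComponent_eq_of_mem {w' : GridV} (hw : w ∈ T) (h : w' ∈ plusComponent T w) :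
    plusComponent T w' = plusComponent T w := by
  refine Set.Subset.antisymm (fun a ha => Relation.ReflTransGen.trans h ha) fun a ha => ?_
  refine Relation.ReflTransGen.trans ?_ ha
  refine plusComponent_induction (P := fun b => w ∈ plusComponent T b) self_mem_plusComponent
    ?_ h
  intro a ha b _ hab hP
  exact Relation.ReflTransGen.head ⟨plusAdj_comm.1 hab, plusComponent_subset hw ha⟩ hP

end plusComponent

/-! ### Interior and exterior of a cycle -/

lemma mem_squareSet {p : ℝ × ℝ} {w : GridV} : p ∈ squareSet w ↔
    ((w.1 : ℝ) - 1 / 2 ≤ p.1 ∧ p.1 ≤ (w.1 : ℝ) + 1 / 2) ∧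
      ((w.2 : ℝ) - 1 / 2 ≤ p.2 ∧ p.2 ≤ (w.2 : ℝ) + 1 / 2) := by
  simp only [squareSet, Set.mem_Icc, Prod.le_def]
  tauto

lemma mem_edgeSeg_horEdge {p : ℝ × ℝ} {x y : ℤ} : p ∈ edgeSeg (horEdge x y) ↔
    ((x : ℝ) - 1 / 2 ≤ p.1 ∧ p.1 ≤ (x : ℝ) + 1 / 2) ∧ p.2 = (y : ℝ) - 1 / 2 := by
  obtain ⟨a, b⟩ := p
  have h : edgeSeg (horEdge x y) =
      (fun t : ℝ => (t, (y : ℝ) - 1 / 2)) '' segment ℝ ((x : ℝ) - 1 / 2) ((x : ℝ) + 1 / 2) := by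
    rw [Prod.image_mk_segment_left]
    simp only [edgeSeg, horEdge, Sym2.lift_mk, toPlane]
    congr 2
    push_cast
    ring
  rw [h, segment_eq_Icc (by linarith)]
  simp only [Set.mem_image, Set.mem_Icc, Prod.mk.injEq]
  constructor
  · rintro ⟨t, h1, rfl, rfl⟩
    exact ⟨h1, rfl⟩
  · rintro ⟨h1, h2⟩
    exact ⟨a, h1, rfl, h2.symm⟩

lemma mem_edgeSeg_vertEdge {p : ℝ × ℝ} {x y : ℤ} : p ∈ edgeSeg (vertEdge x y) ↔
    p.1 = (x : ℝ) - 1 / 2 ∧ ((y : ℝ) - 1 / 2 ≤ p.2 ∧ p.2 ≤ (y : ℝ) + 1 / 2) := by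
  obtain ⟨a, b⟩ := p
  have h : edgeSeg (vertEdge x y) =
      (fun t : ℝ => ((x : ℝ) - 1 / 2, t)) '' segment ℝ ((y : ℝ) - 1 / 2) ((y : ℝ) + 1 / 2) := by
    rw [Prod.image_mk_segment_right]
    simp only [edgeSeg, vertEdge, Sym2.lift_mk, toPlane]
    congr 2
    push_cast
    ring
  rw [h, segment_eq_Icc (by linarith)]
  simp only [Set.mem_image, Set.mem_Icc, Prod.mk.injEq]
  constructor
  · rintro ⟨t, h1, rfl, rfl⟩
    exact ⟨rfl, h1⟩
  · rintro ⟨h1, h2⟩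
    exact ⟨b, h2, h1.symm, rfl⟩

lemma edgeSeg_subset_squareSet {e : Sym2 GridV} {w : GridV} (h : e ∈ squareEdges w) :
    edgeSeg e ⊆ squareSet w := by
  intro p hp
  rcases squareEdges_cases h with ⟨x, y, rfl⟩ | ⟨x, y, rfl⟩
  · rw [mem_edgeSeg_horEdge] at hp
    rw [mem_squareSet]
    rcases horEdge_mem_squareEdges.1 h with rfl | rfl <;> push_cast <;> grind
  · rw [mem_edgeSeg_vertEdge] at hp
    rw [mem_squareSet]
    rcases vertEdge_mem_squareEdges.1 h with rfl | rfl <;> push_cast <;> grind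

lemma exists_mem_squareSet (p : ℝ × ℝ) : ∃ w, p ∈ squareSet w := by
  refine ⟨(⌊p.1 + 1 / 2⌋, ⌊p.2 + 1 / 2⌋), mem_squareSet.2 ?_⟩
  have := Int.floor_le (p.1 + 1 / 2)
  have := Int.lt_floor_add_one (p.1 + 1 / 2)
  have := Int.floor_le (p.2 + 1 / 2)
  have := Int.lt_floor_add_one (p.2 + 1 / 2)
  constructor <;> constructor <;> linarith

lemma finite_squares_meeting {B : Set (ℝ × ℝ)} (hB : Bornology.IsBounded B) :
    {w | (squareSet w ∩ B).Nonempty}.Finite := by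
  obtain ⟨R, hR⟩ := hB.subset_closedBall 0
  refine (Set.finite_Icc ((-(⌈R⌉ + 1), -(⌈R⌉ + 1)) : ℤ × ℤ) (⌈R⌉ + 1, ⌈R⌉ + 1)).subset ?_
  rintro ⟨x, y⟩ ⟨p, hp, hpB⟩
  have h := hR hpB
  rw [mem_closedBall_zero_iff, Prod.norm_def, max_le_iff, Real.norm_eq_abs, Real.norm_eq_abs,
    abs_le, abs_le] at h
  rw [mem_squareSet] at hp
  have := Int.le_ceil R
  simp only at hp
  simp only [Set.mem_Icc, Prod.mk_le_mk]
  refine ⟨⟨?_, ?_⟩, ?_, ?_⟩ <;> (rify; linarith)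

lemma isClosed_biUnion_squareSet (S : Set GridV) : IsClosed (⋃ w ∈ S, squareSet w) := by
  have hlf : LocallyFinite squareSet := fun p =>
    ⟨_, Metric.closedBall_mem_nhds p one_pos, finite_squares_meeting Metric.isBounded_closedBall⟩
  rw [Set.biUnion_eq_iUnion]
  exact (hlf.comp_injective Subtype.val_injective).isClosed_iUnion fun _ => isClosed_Icc

lemma mem_carrierOf {E : Set (Sym2 GridV)} {p : ℝ × ℝ} :
    p ∈ carrierOf E ↔ ∃ e ∈ E, p ∈ edgeSeg e := by
  simp [carrierOf]

lemma mem_carrierOf_edgeBoundary {S : Set GridV} {w w' : GridV} {p : ℝ × ℝ} (hw : w ∈ S)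
    (hw' : w' ∉ S) (hp : p ∈ squareSet w) (hp' : p ∈ squareSet w') :
    p ∈ carrierOf (edgeBoundary S) := by
  have close (a b : ℤ) (t : ℝ) (h1 : (a : ℝ) - 1 / 2 ≤ t) (h2 : t ≤ a + 1 / 2)
      (h3 : (b : ℝ) - 1 / 2 ≤ t) (h4 : t ≤ b + 1 / 2) :
      a = b ∨ (a = b + 1 ∧ t = a - 1 / 2) ∨ (b = a + 1 ∧ t = b - 1 / 2) := by
    have h5 : a ≤ b + 1 := by rify; linarith
    have h6 : b ≤ a + 1 := by rify; linarith
    have : a = b ∨ a = b + 1 ∨ b = a + 1 := by omega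
    rcases this with h | rfl | rfl
    · exact Or.inl h
    · right; left; push_cast at *; exact ⟨rfl, by linarith⟩
    · right; right; push_cast at *; exact ⟨rfl, by linarith⟩
  obtain ⟨a, b⟩ := w
  obtain ⟨a', b'⟩ := w'
  rw [mem_squareSet] at hp hp'
  have hor (x : ℤ) (hx : (x : ℝ) - 1 / 2 ≤ p.1 ∧ p.1 ≤ x + 1 / 2)
      (h : ¬((x, b) ∈ S ↔ (x, b') ∈ S)) : p ∈ carrierOf (edgeBoundary S) := by
    rcases close b b' p.2 hp.2.1 hp.2.2 hp'.2.1 hp'.2.2 with rfl | ⟨rfl, ht⟩ | ⟨rfl, ht⟩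
    · exact absurd Iff.rfl h
    · exact mem_carrierOf.2 ⟨horEdge x (b' + 1), horEdge_mem_edgeBoundary.2 (by simpa using h),
        mem_edgeSeg_horEdge.2 ⟨hx, ht⟩⟩
    · exact mem_carrierOf.2 ⟨horEdge x (b + 1), horEdge_mem_edgeBoundary.2
        (by simpa [iff_comm] using h), mem_edgeSeg_horEdge.2 ⟨hx, ht⟩⟩
  have vert (y : ℤ) (hy : (y : ℝ) - 1 / 2 ≤ p.2 ∧ p.2 ≤ y + 1 / 2)
      (h : ¬((a, y) ∈ S ↔ (a', y) ∈ S)) : p ∈ carrierOf (edgeBoundary S) := by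
    rcases close a a' p.1 hp.1.1 hp.1.2 hp'.1.1 hp'.1.2 with rfl | ⟨rfl, ht⟩ | ⟨rfl, ht⟩
    · exact absurd Iff.rfl h
    · exact mem_carrierOf.2 ⟨vertEdge (a' + 1) y, vertEdge_mem_edgeBoundary.2 (by simpa using h),
        mem_edgeSeg_vertEdge.2 ⟨ht, hy⟩⟩
    · exact mem_carrierOf.2 ⟨vertEdge (a + 1) y, vertEdge_mem_edgeBoundary.2
        (by simpa [iff_comm] using h), mem_edgeSeg_vertEdge.2 ⟨ht, hy⟩⟩
  by_cases hm : (a, b') ∈ S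
  · exact vert b' hp'.2 (by tauto)
  · exact hor a hp.1 (by tauto)

/-- The centre of the square of index `w`. -/
def squareCenter (w : GridV) : ℝ × ℝ := (w.1, w.2)

lemma squareCenter_mem_squareSet (w : GridV) : squareCenter w ∈ squareSet w := by
  rw [mem_squareSet]
  simp only [squareCenter]
  constructor <;> constructor <;> linarith

lemma not_cast_between (a b : ℤ) (h1 : (a : ℝ) < b) (h2 : (b : ℝ) < a + 1) : False := by
  have h1' : a < b := by exact_mod_cast h1
  have h2' : b < a + 1 := by exact_mod_cast h2
  omega

lemma notMem_carrierOf_of_interior {S : Set GridV} {w : GridV} {p : ℝ × ℝ}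
    (h1 : (w.1 : ℝ) - 1 / 2 < p.1 ∧ p.1 < (w.1 : ℝ) + 1 / 2)
    (h2 : (w.2 : ℝ) - 1 / 2 < p.2 ∧ p.2 < (w.2 : ℝ) + 1 / 2) :
    p ∉ carrierOf (edgeBoundary S) := by
  intro h
  obtain ⟨e, he, hp⟩ := mem_carrierOf.1 h
  rcases edgeBoundary_cases he with ⟨x, y, rfl⟩ | ⟨x, y, rfl⟩
  · rw [mem_edgeSeg_horEdge] at hp
    exact not_cast_between w.2 y (by linarith) (by linarith)
  · rw [mem_edgeSeg_vertEdge] at hp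
    exact not_cast_between w.1 x (by linarith) (by linarith)

lemma squareCenter_notMem_carrierOf (S : Set GridV) (w : GridV) :
    squareCenter w ∉ carrierOf (edgeBoundary S) :=
  notMem_carrierOf_of_interior (w := w) (by simp only [squareCenter]; constructor <;> linarith)
    (by simp only [squareCenter]; constructor <;> linarith)

lemma connectedComponentIn_eq_of_segment {X : Set (ℝ × ℝ)} {p q : ℝ × ℝ}
    (h : segment ℝ p q ⊆ X) : connectedComponentIn X p = connectedComponentIn X q :=
  connectedComponentIn_eq <| (convex_segment p q).isPreconnected.subset_connectedComponentIn
    (left_mem_segment ℝ p q) h (right_mem_segment ℝ p q)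

lemma connectedComponentIn_eq_squareCenter {S : Set GridV} {w : GridV} {p : ℝ × ℝ}
    (hp : p ∈ squareSet w) (hpS : p ∉ carrierOf (edgeBoundary S)) :
    connectedComponentIn (carrierOf (edgeBoundary S))ᶜ p =
      connectedComponentIn (carrierOf (edgeBoundary S))ᶜ (squareCenter w) := by
  refine connectedComponentIn_eq_of_segment ?_
  rintro q ⟨a, b, ha, hb, hab, rfl⟩
  rcases hb.eq_or_lt with rfl | hb
  · obtain rfl : a = 1 := by linarith
    simpa using hpS
  · rw [mem_squareSet] at hp
    obtain rfl : a = 1 - b := by linarith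
    refine notMem_carrierOf_of_interior (w := w) ?_ ?_
    · simp only [squareCenter, Prod.fst_add, Prod.smul_fst, smul_eq_mul]
      constructor <;> nlinarith
    · simp only [squareCenter, Prod.snd_add, Prod.smul_snd, smul_eq_mul]
      constructor <;> nlinarith

lemma connectedComponentIn_squareCenter_eq {S : Set GridV} {w w' : GridV} (hadj : plusAdj w w')
    (h : w ∈ S ↔ w' ∈ S) :
    connectedComponentIn (carrierOf (edgeBoundary S))ᶜ (squareCenter w) =
      connectedComponentIn (carrierOf (edgeBoundary S))ᶜ (squareCenter w') := by
  have hor (x y : ℤ) (h : (x, y) ∈ S ↔ (x - 1, y) ∈ S) :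
      connectedComponentIn (carrierOf (edgeBoundary S))ᶜ (squareCenter (x, y)) =
        connectedComponentIn (carrierOf (edgeBoundary S))ᶜ (squareCenter (x - 1, y)) := by
    refine connectedComponentIn_eq_of_segment ?_
    rintro q ⟨a, b, ha, hb, hab, rfl⟩ hq
    obtain rfl : a = 1 - b := by linarith
    obtain ⟨e, he, hp⟩ := mem_carrierOf.1 hq
    rcases edgeBoundary_cases he with ⟨x', y', rfl⟩ | ⟨x', y', rfl⟩
    · rw [mem_edgeSeg_horEdge] at hp
      simp only [squareCenter, Prod.snd_add, Prod.smul_snd, smul_eq_mul] at hp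
      exact not_cast_between y y' (by linarith) (by linarith)
    · rw [mem_edgeSeg_vertEdge] at hp
      simp only [squareCenter, Prod.snd_add, Prod.smul_snd, Prod.fst_add, Prod.smul_fst,
        smul_eq_mul] at hp
      push_cast at hp
      have h1 : x' = x := by
        have : x - 1 < x' := by rify; linarith
        have : x' < x + 1 := by rify; linarith
        omega
      have h2 : y' = y := by
        have : y - 1 < y' := by rify; linarith
        have : y' < y + 1 := by rify; linarith
        omega
      subst h1 h2
      exact vertEdge_mem_edgeBoundary.1 he h
  have vert (x y : ℤ) (h : (x, y) ∈ S ↔ (x, y - 1) ∈ S) :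
      connectedComponentIn (carrierOf (edgeBoundary S))ᶜ (squareCenter (x, y)) =
        connectedComponentIn (carrierOf (edgeBoundary S))ᶜ (squareCenter (x, y - 1)) := by
    refine connectedComponentIn_eq_of_segment ?_
    rintro q ⟨a, b, ha, hb, hab, rfl⟩ hq
    obtain rfl : a = 1 - b := by linarith
    obtain ⟨e, he, hp⟩ := mem_carrierOf.1 hq
    rcases edgeBoundary_cases he with ⟨x', y', rfl⟩ | ⟨x', y', rfl⟩
    · rw [mem_edgeSeg_horEdge] at hp
      simp only [squareCenter, Prod.snd_add, Prod.smul_snd, Prod.fst_add, Prod.smul_fst,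
        smul_eq_mul] at hp
      push_cast at hp
      have h1 : x' = x := by
        have : x - 1 < x' := by rify; linarith
        have : x' < x + 1 := by rify; linarith
        omega
      have h2 : y' = y := by
        have : y - 1 < y' := by rify; linarith
        have : y' < y + 1 := by rify; linarith
        omega
      subst h1 h2
      exact horEdge_mem_edgeBoundary.1 he h
    · rw [mem_edgeSeg_vertEdge] at hp
      simp only [squareCenter, Prod.fst_add, Prod.smul_fst, smul_eq_mul] at hp
      exact not_cast_between x x' (by linarith) (by linarith)
  obtain ⟨e, hew, hew'⟩ := exists_mem_squareEdges_of_plusAdj hadj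
  rcases squareEdges_cases hew with ⟨x, y, rfl⟩ | ⟨x, y, rfl⟩
  · rcases horEdge_mem_squareEdges.1 hew with rfl | rfl <;>
    rcases horEdge_mem_squareEdges.1 hew' with rfl | rfl
    · rfl
    · exact vert _ _ h
    · exact (vert _ _ h.symm).symm
    · rfl
  · rcases vertEdge_mem_squareEdges.1 hew with rfl | rfl <;>
    rcases vertEdge_mem_squareEdges.1 hew' with rfl | rfl
    · rfl
    · exact hor _ _ h
    · exact (hor _ _ h.symm).symm
    · rfl

section Interior

variable {S : Set GridV}

lemma mem_interiorOf (hS : S.Finite) {w : GridV} (hw : w ∈ S) {p : ℝ × ℝ} (hp : p ∈ squareSet w)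
    (hpS : p ∉ carrierOf (edgeBoundary S)) : p ∈ interiorOf (edgeBoundary S) := by
  refine ⟨hpS, ?_⟩
  have hbdd : Bornology.IsBounded (⋃ w ∈ S, squareSet w) :=
    (Bornology.isBounded_biUnion hS).2 fun w _ => Metric.isBounded_Icc _ _
  refine hbdd.subset ?_
  refine isPreconnected_iff_subset_of_disjoint_closed.1
    (isPreconnected_connectedComponentIn (F := (carrierOf (edgeBoundary S))ᶜ) (x := p))
    _ (⋃ w ∈ Sᶜ, squareSet w) (isClosed_biUnion_squareSet S) (isClosed_biUnion_squareSet Sᶜ)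
    ?_ ?_ |>.resolve_right ?_
  · intro q _
    obtain ⟨t, ht⟩ := exists_mem_squareSet q
    by_cases hts : t ∈ S
    · exact Or.inl (Set.mem_biUnion hts ht)
    · exact Or.inr (Set.mem_biUnion (show t ∈ Sᶜ from hts) ht)
  · rw [Set.eq_empty_iff_forall_notMem]
    rintro q ⟨hq, h1, h2⟩
    simp only [Set.mem_iUnion] at h1 h2
    obtain ⟨t, ht, hqt⟩ := h1
    obtain ⟨t', ht', hqt'⟩ := h2
    exact connectedComponentIn_subset _ _ hq (mem_carrierOf_edgeBoundary ht ht' hqt hqt')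
  · intro hsub
    have := hsub (mem_connectedComponentIn hpS)
    simp only [Set.mem_iUnion] at this
    obtain ⟨t', ht', hqt'⟩ := this
    exact hpS (mem_carrierOf_edgeBoundary hw ht' hp hqt')

variable (hS : S.Finite) (hcyc : IsCycle (edgeBoundary S))

include hS hcyc

lemma mem_exteriorOf {w : GridV} (hw : w ∉ S) {p : ℝ × ℝ} (hp : p ∈ squareSet w)
    (hpS : p ∉ carrierOf (edgeBoundary S)) : p ∈ exteriorOf (edgeBoundary S) := by
  refine ⟨hpS, fun hbdd => ?_⟩
  rw [connectedComponentIn_eq_squareCenter hp hpS] at hbdd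
  have hcomp {w'} (hw' : w' ∈ plusComponent Sᶜ w) :
      connectedComponentIn (carrierOf (edgeBoundary S))ᶜ (squareCenter w) =
      connectedComponentIn (carrierOf (edgeBoundary S))ᶜ (squareCenter w') := by
    refine plusComponent_induction (P := fun w' =>
      connectedComponentIn (carrierOf (edgeBoundary S))ᶜ (squareCenter w) =
      connectedComponentIn (carrierOf (edgeBoundary S))ᶜ (squareCenter w')) rfl ?_ hw'
    intro a ha b hb hab hP
    have ha' : a ∉ S := plusComponent_subset hw ha
    have hb' : b ∉ S := plusComponent_subset hw hb
    exact hP.trans (connectedComponentIn_squareCenter_eq hab (by tauto))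
  have hfin : (plusComponent Sᶜ w).Finite := by
    refine (finite_squares_meeting hbdd).subset fun w' hw' => ?_
    refine ⟨squareCenter w', squareCenter_mem_squareSet w', ?_⟩
    rw [hcomp hw']
    exact mem_connectedComponentIn (squareCenter_notMem_carrierOf S w')
  have hsub := edgeBoundary_plusComponent_subset (T := Sᶜ) hw
  rw [edgeBoundary_compl] at hsub
  rcases hcyc.eq_empty_or_eq hS hfin hsub with h | h
  · exact (h ▸ self_mem_plusComponent : w ∈ (∅ : Set GridV))
  · exact hw (h ▸ self_mem_plusComponent)

omit hcyc in
lemma inInterior_squareSet {w : GridV} (hw : w ∈ S) :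
    inInterior (edgeBoundary S) (squareSet w) := by
  intro p hp
  by_cases hpS : p ∈ carrierOf (edgeBoundary S)
  · exact Or.inr hpS
  · exact Or.inl (mem_interiorOf hS hw hp hpS)

lemma inExterior_squareSet {w : GridV} (hw : w ∉ S) :
    inExterior (edgeBoundary S) (squareSet w) := by
  intro p hp
  by_cases hpS : p ∈ carrierOf (edgeBoundary S)
  · exact Or.inr hpS
  · exact Or.inl (mem_exteriorOf hS hcyc hw hp hpS)

lemma mem_of_inInterior {A : Set (ℝ × ℝ)} (hA : inInterior (edgeBoundary S) A) {w : GridV}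
    {p : ℝ × ℝ} (hpA : p ∈ A) (hp : p ∈ squareSet w)
    (hpS : p ∉ carrierOf (edgeBoundary S)) : w ∈ S := by
  by_contra hw
  have h1 := (hA hpA).resolve_right hpS
  exact (mem_exteriorOf hS hcyc hw hp hpS).2 h1.2

lemma mem_of_inInterior_squareSet {w : GridV}
    (h : inInterior (edgeBoundary S) (squareSet w)) : w ∈ S :=
  mem_of_inInterior hS hcyc h (squareCenter_mem_squareSet w) (squareCenter_mem_squareSet w)
    (squareCenter_notMem_carrierOf S w)

lemma mem_of_inInterior_edgeSeg {e : Sym2 GridV} (he : e ∉ edgeBoundary S)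
    (h : inInterior (edgeBoundary S) (edgeSeg e)) {w : GridV} (hw : e ∈ squareEdges w) :
    w ∈ S := by
  rcases squareEdges_cases hw with ⟨x, y, rfl⟩ | ⟨x, y, rfl⟩
  · have hmem : ((x : ℝ), (y : ℝ) - 1 / 2) ∈ edgeSeg (horEdge x y) :=
      mem_edgeSeg_horEdge.2 ⟨⟨by dsimp only; linarith, by dsimp only; linarith⟩, rfl⟩
    refine mem_of_inInterior hS hcyc h hmem (edgeSeg_subset_squareSet hw hmem) fun hc => ?_
    obtain ⟨e', he', hp⟩ := mem_carrierOf.1 hc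
    rcases edgeBoundary_cases he' with ⟨x', y', rfl⟩ | ⟨x', y', rfl⟩
    · rw [mem_edgeSeg_horEdge] at hp
      dsimp only at hp
      have h1 : x' = x := by
        have : x - 1 < x' := by rify; linarith
        have : x' < x + 1 := by rify; linarith
        omega
      have h2 : y' = y := by rify; linarith
      exact he (h1 ▸ h2 ▸ he')
    · rw [mem_edgeSeg_vertEdge] at hp
      exact not_cast_between x x' (by linarith) (by linarith)
  · have hmem : ((x : ℝ) - 1 / 2, (y : ℝ)) ∈ edgeSeg (vertEdge x y) :=
      mem_edgeSeg_vertEdge.2 ⟨rfl, by dsimp only; linarith, by dsimp only; linarith⟩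
    refine mem_of_inInterior hS hcyc h hmem (edgeSeg_subset_squareSet hw hmem) fun hc => ?_
    obtain ⟨e', he', hp⟩ := mem_carrierOf.1 hc
    rcases edgeBoundary_cases he' with ⟨x', y', rfl⟩ | ⟨x', y', rfl⟩
    · rw [mem_edgeSeg_horEdge] at hp
      exact not_cast_between y y' (by linarith) (by linarith)
    · rw [mem_edgeSeg_vertEdge] at hp
      dsimp only at hp
      have h1 : x' = x := by rify; linarith
      have h2 : y' = y := by
        have : y - 1 < y' := by rify; linarith
        have : y' < y + 1 := by rify; linarith
        omega
      exact he (h1 ▸ h2 ▸ he')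

end Interior

/-! ### The filled region of a finite set of squares -/

lemma mem_biUnion_squareEdges {C : Set GridV} {e : Sym2 GridV} {a b : GridV}
    (h : e ∈ ⋃ z ∈ C, squareEdges z) (ha : e ∈ squareEdges a) (hb : e ∈ squareEdges b)
    (hne : a ≠ b) : a ∈ C ∨ b ∈ C := by
  simp only [Set.mem_iUnion] at h
  obtain ⟨t, ht, het⟩ := h
  rcases eq_or_eq_of_mem_squareEdges ha hb hne het with rfl | rfl
  · exact Or.inl ht
  · exact Or.inr ht

/-- The union of all finite sets of squares whose edge boundary consists of edges of squares in
`C`, that is, `C` together with the squares which it encloses. -/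
def filling (C : Set GridV) : Set GridV :=
  ⋃₀ {S | S.Finite ∧ edgeBoundary S ⊆ ⋃ z ∈ C, squareEdges z}

section filling

variable {C : Set GridV}

lemma subset_filling_of_edgeBoundary_subset {S : Set GridV} (hS : S.Finite)
    (h : edgeBoundary S ⊆ ⋃ z ∈ C, squareEdges z) : S ⊆ filling C :=
  Set.subset_sUnion_of_mem ⟨hS, h⟩

lemma subset_filling : C ⊆ filling C := by
  intro z hz
  refine subset_filling_of_edgeBoundary_subset (Set.finite_singleton z) ?_ rfl
  rintro e ⟨w, rfl, w', -, h, -⟩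
  exact Set.mem_biUnion hz h

lemma edgeBoundary_filling_subset :
    edgeBoundary (filling C) ⊆ ⋃ z ∈ C, squareEdges z := by
  rintro e ⟨a, ⟨S, hS, haS⟩, b, hb, hea, heb⟩
  exact hS.2 ⟨a, haS, b, fun h => hb ⟨S, hS, h⟩, hea, heb⟩

lemma finite_filling (hC : C.Finite) : (filling C).Finite := by
  refine (hC.biUnion fun c _ => hC.biUnion fun c' _ => Set.finite_Icc c c').subset ?_
  rintro ⟨x, y⟩ ⟨S, ⟨hS, hbd⟩, h⟩
  have hleft : ∃ c ∈ C, c ≤ (x, y) := by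
    obtain ⟨x', h1, h2, h3⟩ := exists_leaving_left hS h
    have he := hbd (vertEdge_mem_edgeBoundary.2
      (show ¬((x', y) ∈ S ↔ (x' - 1, y) ∈ S) by have := h2 x' le_rfl h1; tauto))
    simp only [Set.mem_iUnion, vertEdge_mem_squareEdges] at he
    obtain ⟨c, hc, rfl | rfl⟩ := he
    · exact ⟨_, hc, by simpa using h1⟩
    · exact ⟨_, hc, by simp only [Prod.mk_le_mk, le_refl, and_true]; omega⟩
  have hright : ∃ c ∈ C, (x, y) ≤ c := by
    obtain ⟨x', h1, h2, h3⟩ := exists_leaving_right hS h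
    have he := hbd (vertEdge_mem_edgeBoundary.2
      (show ¬((x' + 1, y) ∈ S ↔ (x' + 1 - 1, y) ∈ S) by
        have := h2 x' h1 le_rfl
        rw [add_sub_cancel_right]
        tauto))
    simp only [Set.mem_iUnion, vertEdge_mem_squareEdges] at he
    obtain ⟨c, hc, rfl | rfl⟩ := he
    · exact ⟨_, hc, by simp only [Prod.mk_le_mk, le_refl, and_true]; omega⟩
    · exact ⟨_, hc, by simpa using h1⟩
  obtain ⟨c, hc, hc1⟩ := hleft
  obtain ⟨c', hc', hc1'⟩ := hright
  exact Set.mem_biUnion hc (Set.mem_biUnion hc' ⟨hc1, hc1'⟩)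

variable {z : GridV}

/-- An edge of the boundary of a component of the filling separates a square of `C` in this
component from a square outside the filling. -/
lemma edgeBoundary_component_cases (hz : z ∈ filling C) {e : Sym2 GridV}
    (he : e ∈ edgeBoundary (plusComponent (filling C) z)) :
    ∃ a ∈ plusComponent (filling C) z, a ∈ C ∧ e ∈ squareEdges a ∧
      ∃ b ∉ filling C, e ∈ squareEdges b ∧ plusAdj a b := by
  have hmem := edgeBoundary_filling_subset (edgeBoundary_plusComponent_subset hz he)
  obtain ⟨a, ha, b, hb, hea, heb⟩ := he
  have hne : a ≠ b := by
    rintro rfl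
    exact hb ha
  have hadj := plusAdj_of_mem_squareEdges hea heb hne
  have hbA : b ∉ filling C := fun h => hb (mem_plusComponent_of_plusAdj ha hadj h)
  refine ⟨a, ha, ?_, hea, b, hbA, heb, hadj⟩
  exact (mem_biUnion_squareEdges hmem hea heb hne).resolve_right fun h => hbA (subset_filling h)

lemma finite_component (hC : C.Finite) (hz : z ∈ filling C) :
    (plusComponent (filling C) z).Finite :=
  (finite_filling hC).subset (plusComponent_subset hz)

/-- A nonempty finite set of squares whose boundary lies on the boundary of a component of the
filling is this component. -/
lemma eq_component_of_edgeBoundary_subset (hC : C.Finite) (hz : z ∈ filling C) {I : Set GridV}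
    (hI : I.Finite) (hne : I.Nonempty)
    (hsub : edgeBoundary I ⊆ edgeBoundary (plusComponent (filling C) z)) :
    I = plusComponent (filling C) z := by
  have hIA : I ⊆ filling C := subset_filling_of_edgeBoundary_subset hI
    ((hsub.trans (edgeBoundary_plusComponent_subset hz)).trans edgeBoundary_filling_subset)
  have hIB : I ⊆ plusComponent (filling C) z := by
    intro w hw
    by_contra hwB
    have hdisj : ∀ a ∈ plusComponent (filling C) w, a ∉ plusComponent (filling C) z := by
      intro a ha ha'
      apply hwB
      rw [← plusComponent_eq_of_mem hz ha', plusComponent_eq_of_mem (hIA hw) ha]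
      exact self_mem_plusComponent
    have hwI : ∀ a ∈ plusComponent (filling C) w, a ∈ I := fun a ha => by
      refine plusComponent_induction (P := (· ∈ I)) hw (fun a ha b hb hab haI => ?_) ha
      by_contra hbI
      obtain ⟨e, hea, heb⟩ := exists_mem_squareEdges_of_plusAdj hab
      obtain ⟨t, ht, -, het, -⟩ :=
        edgeBoundary_component_cases hz (hsub ⟨a, haI, b, hbI, hea, heb⟩)
      have hab' : a ≠ b := by
        rintro rfl
        exact hbI haI
      rcases eq_or_eq_of_mem_squareEdges hea heb hab' het with rfl | rfl
      · exact hdisj _ ha ht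
      · exact hdisj _ hb ht
    obtain ⟨e, he⟩ := exists_mem_edgeBoundary (finite_component hC (hIA hw))
      ⟨w, self_mem_plusComponent⟩
    obtain ⟨a, ha, -, hea, b, hb, heb, hab⟩ := edgeBoundary_component_cases (hIA hw) he
    have hbI : b ∉ I := fun h => hb (hIA h)
    obtain ⟨t, ht, -, het, -⟩ :=
      edgeBoundary_component_cases hz (hsub ⟨a, hwI a ha, b, hbI, hea, heb⟩)
    have hab' : a ≠ b := by
      rintro rfl
      exact hbI (hwI _ ha)
    rcases eq_or_eq_of_mem_squareEdges hea heb hab' het with rfl | rfl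
    · exact hdisj _ ha ht
    · exact hb (plusComponent_subset hz ht)
  refine hIB.antisymm ?_
  obtain ⟨w, hw⟩ := hne
  rw [← plusComponent_eq_of_mem hz (hIB hw)] at hsub ⊢
  refine fun a ha => plusComponent_induction (P := (· ∈ I)) hw (fun a ha b hb hab haI => ?_) ha
  by_contra hbI
  obtain ⟨e, hea, heb⟩ := exists_mem_squareEdges_of_plusAdj hab
  obtain ⟨s, hs, t, ht, hes, het⟩ := hsub ⟨a, haI, b, hbI, hea, heb⟩
  have hab' : a ≠ b := by
    rintro rfl
    exact hbI haI
  rcases eq_or_eq_of_mem_squareEdges hea heb hab' het with rfl | rfl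
  · exact ht ha
  · exact ht hb

lemma isCycle_edgeBoundary_component (hC : C.Finite) (hz : z ∈ filling C) :
    IsCycle (edgeBoundary (plusComponent (filling C) z)) := by
  have hfin := finite_component hC hz
  obtain ⟨D, hD, hsub⟩ := exists_isCycle_subset (finite_edgeBoundary hfin)
    (exists_mem_edgeBoundary hfin ⟨z, self_mem_plusComponent⟩) (fun e => edgeBoundary_cases)
    (isPotential_indicator _).chainDeg_eq_zero
  obtain ⟨I, hI, rfl⟩ := hD.exists_edgeBoundary_eq
  have hne : I.Nonempty := by
    obtain ⟨e, a, ha, -⟩ := hD.nonempty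
    exact ⟨a, ha⟩
  rwa [← eq_component_of_edgeBoundary_subset hC hz hI hne hsub]

/-- The squares enclosed by a cycle around `z` made of edges of squares of `C` belong to the
component of `z` in the filling. -/
lemma subset_component {I : Set GridV} (hI : I.Finite) (hcyc : IsCycle (edgeBoundary I))
    (hsub : edgeBoundary I ⊆ ⋃ z ∈ C, squareEdges z) (hz : z ∈ I) :
    I ⊆ plusComponent (filling C) z := by
  have hIA := subset_filling_of_edgeBoundary_subset hI hsub
  have h : plusComponent I z = I := by
    refine (hcyc.eq_empty_or_eq hI (hI.subset (plusComponent_subset hz))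
      (edgeBoundary_plusComponent_subset hz)).resolve_left fun h => ?_
    exact (h ▸ self_mem_plusComponent : z ∈ (∅ : Set GridV))
  intro w hw
  rw [← h] at hw
  refine plusComponent_induction self_mem_plusComponent (fun a _ b hb hab ha => ?_) hw
  exact mem_plusComponent_of_plusAdj ha hab (hIA (plusComponent_subset hz hb))

end filling

/-! ### Identification of the outermost boundary cycles -/

section outermost

variable {ω : GridV → Prop} (hfin : (starComp ω).Finite) {z : GridV} (hz : z ∈ starComp ω)

lemma starAdj_of_plusAdj {a b : GridV} (h : plusAdj a b) : starAdj a b := by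
  refine ⟨?_, ?_, ?_⟩
  · rintro rfl
    simp [plusAdj] at h
  · exact h ▸ le_add_of_nonneg_right (abs_nonneg _)
  · exact h ▸ le_add_of_nonneg_left (abs_nonneg _)

lemma mem_starComp_of_starAdj {a b : GridV} (ha : a ∈ starComp ω) (h : starAdj a b) (hb : ω b) :
    b ∈ starComp ω :=
  ⟨hb, ha.2.tail ⟨ha.1, hb, h⟩⟩

include hfin hz

lemma isOutermostCycleOf_component :
    isOutermostCycleOf ω z (edgeBoundary (plusComponent (filling (starComp ω)) z)) := by
  have hzA := subset_filling hz
  have hB := finite_component hfin hzA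
  have hcyc := isCycle_edgeBoundary_component hfin hzA
  refine ⟨⟨hcyc, (edgeBoundary_plusComponent_subset hzA).trans edgeBoundary_filling_subset⟩,
    inInterior_squareSet hB self_mem_plusComponent, fun e he => ?_, ?_⟩
  · obtain ⟨a, ha, haC, hea, b, hb, heb, hab⟩ := edgeBoundary_component_cases hzA he
    refine ⟨⟨a, haC, hea, inInterior_squareSet hB ha⟩, b, fun hωb => ?_, heb,
      inExterior_squareSet hB hcyc fun h => hb (plusComponent_subset hzA h)⟩
    exact hb (subset_filling (mem_starComp_of_starAdj haC (starAdj_of_plusAdj hab) hωb))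
  · rintro D ⟨hD, hDsub⟩ hint e he
    obtain ⟨I, hI, rfl⟩ := hD.exists_edgeBoundary_eq
    have hIB := subset_component hI hD hDsub (mem_of_inInterior_squareSet hI hD hint)
    obtain ⟨a, ha, -, -, hea, -⟩ := he
    exact Or.inr ((edgeSeg_subset_squareSet hea).trans (inInterior_squareSet hB (hIB ha)))

lemma eq_of_isOutermostCycleOf {D : Set (Sym2 GridV)} (hD : isOutermostCycleOf ω z D) :
    D = edgeBoundary (plusComponent (filling (starComp ω)) z) := by
  have hzA := subset_filling hz
  have hB := finite_component hfin hzA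
  obtain ⟨⟨hBcyc, hBsub⟩, hBint, -, -⟩ := isOutermostCycleOf_component hfin hz
  obtain ⟨⟨hcyc, hsub⟩, hint, -, hmax⟩ := hD
  obtain ⟨I, hI, rfl⟩ := hcyc.exists_edgeBoundary_eq
  have hzI := mem_of_inInterior_squareSet hI hcyc hint
  have hIB := subset_component hI hcyc hsub hzI
  have hle : edgeBoundary (plusComponent (filling (starComp ω)) z) ⊆ edgeBoundary I := by
    intro e he
    by_contra heI
    have h := (hmax _ ⟨hBcyc, hBsub⟩ hBint e he).resolve_left heI
    obtain ⟨a, ha, b, hb, hea, heb⟩ := he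
    exact hb (hIB (mem_of_inInterior_edgeSeg hI hcyc heI h heb))
  rcases hcyc.eq_empty_or_eq hI hB hle with h | h
  · exact absurd self_mem_plusComponent (h ▸ Set.notMem_empty z)
  · rw [h]

end outermost

/-! ### Corners shared by plus components -/

/-- `v` is a corner of the square `a`. -/
def IsCornerOf (v a : GridV) : Prop := (a.1 = v.1 ∨ a.1 = v.1 - 1) ∧ (a.2 = v.2 ∨ a.2 = v.2 - 1)

lemma isCornerOf_of_mem_squareEdges {e : Sym2 GridV} {v a : GridV} (he : e ∈ squareEdges a)
    (hv : v ∈ e) : IsCornerOf v a := by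
  obtain ⟨v1, v2⟩ := v
  obtain ⟨a1, a2⟩ := a
  simp only [squareEdges, Set.mem_insert_iff, Set.mem_singleton_iff] at he
  rcases he with rfl | rfl | rfl | rfl <;>
    simp only [Sym2.mem_iff, Prod.mk.injEq, Prod.mk_add_mk] at hv <;>
    simp only [IsCornerOf] <;> omega

lemma exists_isCornerOf_of_mem_vertexSetOf {S : Set GridV} {v : GridV}
    (hv : v ∈ vertexSetOf (edgeBoundary S)) : ∃ a ∈ S, IsCornerOf v a :=
  let ⟨_, ⟨a, ha, _, _, hea, _⟩, hve⟩ := hv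
  ⟨a, ha, isCornerOf_of_mem_squareEdges hea hve⟩

lemma exists_common_edge_of_isCornerOf {v a b : GridV} (ha : IsCornerOf v a) (hb : IsCornerOf v b)
    (hab : plusAdj a b) : ∃ e, e ∈ squareEdges a ∧ e ∈ squareEdges b ∧ v ∈ e := by
  obtain ⟨v1, v2⟩ := v
  obtain ⟨a1, a2⟩ := a
  obtain ⟨b1, b2⟩ := b
  have hcases := abs_add_abs_eq_one_cases hab
  simp only [IsCornerOf] at ha hb hcases
  by_cases h : a2 = b2
  · refine ⟨vertEdge v1 a2, vertEdge_mem_squareEdges.2 ?_, vertEdge_mem_squareEdges.2 ?_, ?_⟩ <;>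
      simp only [vertEdge, Sym2.mem_iff, Prod.mk.injEq, and_true,
        true_and] <;> omega
  · refine ⟨horEdge a1 v2, horEdge_mem_squareEdges.2 ?_, horEdge_mem_squareEdges.2 ?_, ?_⟩ <;>
      simp only [horEdge, Sym2.mem_iff, Prod.mk.injEq, and_true,
        true_and] <;> omega

lemma mem_vertexSetOf_edgeBoundary {S : Set GridV} {v a b : GridV} (ha : a ∈ S) (hb : b ∉ S)
    (hva : IsCornerOf v a) (hvb : IsCornerOf v b) : v ∈ vertexSetOf (edgeBoundary S) := by
  have key {a b : GridV} (ha : a ∈ S) (hb : b ∉ S) (hva : IsCornerOf v a) (hvb : IsCornerOf v b)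
      (hab : plusAdj a b) : v ∈ vertexSetOf (edgeBoundary S) := by
    obtain ⟨e, hea, heb, hve⟩ := exists_common_edge_of_isCornerOf hva hvb hab
    exact ⟨e, ⟨a, ha, b, hb, hea, heb⟩, hve⟩
  have hstep {a b : GridV} (hva : IsCornerOf v a) (hvb : IsCornerOf v b)
      (h : a.1 = b.1 ∨ a.2 = b.2) : a = b ∨ plusAdj a b := by
    simp only [IsCornerOf, plusAdj, Prod.ext_iff] at *
    grind
  have hvm : IsCornerOf v (a.1, b.2) := ⟨hva.1, hvb.2⟩
  by_cases hm : (a.1, b.2) ∈ S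
  · rcases hstep hvm hvb (Or.inr rfl) with h | h
    · exact absurd (h ▸ hm) hb
    · exact key hm hb hvm hvb h
  · rcases hstep hva hvm (Or.inl rfl) with h | h
    · exact absurd (h ▸ ha) hm
    · exact key ha hm hva hvm h

lemma exists_isCornerOf_of_starAdj {a b : GridV} (h : starAdj a b) :
    ∃ v, IsCornerOf v a ∧ IsCornerOf v b := by
  obtain ⟨-, h1, h2⟩ := h
  rw [abs_le] at h1 h2
  refine ⟨(max a.1 b.1, max a.2 b.2), ?_, ?_⟩ <;> simp only [IsCornerOf] <;> omega

/-- The sets `B i` are pairwise disjoint unions of plus components of `A`. -/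
structure IsPlusSeparated {ι : Type*} (A : Set GridV) (B : ι → Set GridV) : Prop where
  subset : ∀ i, B i ⊆ A
  mem_of_plusAdj : ∀ {i a b}, a ∈ B i → plusAdj a b → b ∈ A → b ∈ B i
  eq_of_mem : ∀ {i j a}, a ∈ B i → a ∈ B j → i = j

namespace IsPlusSeparated

variable {ι : Type*} {A : Set GridV} {B : ι → Set GridV} (hB : IsPlusSeparated A B)

include hB

lemma edgeBoundary_subset (i : ι) : edgeBoundary (B i) ⊆ edgeBoundary A := by
  rintro e ⟨a, ha, b, hb, hea, heb⟩
  have hne : a ≠ b := fun h => hb (h ▸ ha)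
  exact ⟨a, hB.subset i ha, b,
    fun h => hb (hB.mem_of_plusAdj ha (plusAdj_of_mem_squareEdges hea heb hne) h), hea, heb⟩

lemma eq_of_mem_edgeBoundary {i j : ι} {e : Sym2 GridV} (hi : e ∈ edgeBoundary (B i))
    (hj : e ∈ edgeBoundary (B j)) : i = j := by
  obtain ⟨a, ha, b, hb, hea, heb⟩ := hi
  obtain ⟨c, hc, -, -, hec, -⟩ := hj
  have hne : a ≠ b := fun h => hb (h ▸ ha)
  rcases eq_or_eq_of_mem_squareEdges hea heb hne hec with rfl | rfl
  · exact hB.eq_of_mem ha hc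
  · exact absurd (hB.mem_of_plusAdj ha (plusAdj_of_mem_squareEdges hea heb hne)
      (hB.subset j hc)) hb

lemma indicator_eq_zero {i k : ι} (hik : i ≠ k) {P : Sym2 GridV → ZMod 2}
    (hP : Function.support P ⊆ edgeBoundary (B k)) : (edgeBoundary (B i)).indicator P = 0 := by
  refine Set.indicator_eq_zero.2 <| Set.disjoint_left.2 fun e he hei => hik ?_
  exact hB.eq_of_mem_edgeBoundary hei (hP he)

lemma eq_or_eq_of_mem_vertexSetOf {i j k : ι} (hij : i ≠ j) {v : GridV}
    (hi : v ∈ vertexSetOf (edgeBoundary (B i))) (hj : v ∈ vertexSetOf (edgeBoundary (B j)))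
    (hk : v ∈ vertexSetOf (edgeBoundary (B k))) : k = i ∨ k = j := by
  obtain ⟨a, ha, hva⟩ := exists_isCornerOf_of_mem_vertexSetOf hi
  obtain ⟨b, hb, hvb⟩ := exists_isCornerOf_of_mem_vertexSetOf hj
  obtain ⟨c, hc, hvc⟩ := exists_isCornerOf_of_mem_vertexSetOf hk
  have key {i j : ι} {a b : GridV} (ha : a ∈ B i) (hb : b ∈ B j) (hva : IsCornerOf v a)
      (hvb : IsCornerOf v b) (h : a.1 = b.1 ∨ a.2 = b.2) : i = j := by
    have : a = b ∨ plusAdj a b := by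
      simp only [IsCornerOf, plusAdj, Prod.ext_iff] at *
      grind
    rcases this with rfl | hadj
    · exact hB.eq_of_mem ha hb
    · exact hB.eq_of_mem (hB.mem_of_plusAdj ha hadj (hB.subset j hb)) hb
  have h1 : a.1 ≠ b.1 := fun h => hij (key ha hb hva hvb (Or.inl h))
  have h2 := key hc ha hvc hva
  have h3 := key hc hb hvc hvb
  simp only [IsCornerOf] at hva hvb hvc
  by_cases h : c.1 = a.1
  · exact Or.inl (h2 (Or.inl h))
  · have : c.1 = b.1 := by omega
    exact Or.inr (h3 (Or.inl this))

/-- A potential of a chain supported on the boundary of `A` restricts to each `B i`. -/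
lemma isPotential_indicator {F : Sym2 GridV → ZMod 2} {p : GridV → ZMod 2}
    (hF : Function.support F ⊆ edgeBoundary A) (hp : Function.support p ⊆ A)
    (hpot : IsPotential F p) (i : ι) :
    IsPotential ((edgeBoundary (B i)).indicator F) ((B i).indicator p) := by
  have key {e : Sym2 GridV} {a b : GridV} (hab : plusAdj a b)
      (hA : e ∈ edgeBoundary A ↔ ¬(a ∈ A ↔ b ∈ A))
      (hi : e ∈ edgeBoundary (B i) ↔ ¬(a ∈ B i ↔ b ∈ B i)) (hFe : F e = p a + p b) :
      (edgeBoundary (B i)).indicator F e = (B i).indicator p a + (B i).indicator p b := by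
    have h0 : e ∉ edgeBoundary A → F e = 0 := fun h => by
      by_contra h'
      exact h (hF h')
    have hp0 {w : GridV} : w ∉ A → p w = 0 := fun h => by
      by_contra h'
      exact h (hp h')
    by_cases h1 : a ∈ B i <;> by_cases h2 : b ∈ B i
    · have he : e ∉ edgeBoundary (B i) := by tauto
      have heA : e ∉ edgeBoundary A := fun h =>
        hA.1 h (iff_of_true (hB.subset i h1) (hB.subset i h2))
      rw [Set.indicator_of_notMem he, Set.indicator_of_mem h1, Set.indicator_of_mem h2, ← hFe,
        h0 heA]
    · have hb : b ∉ A := fun h => h2 (hB.mem_of_plusAdj h1 hab h)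
      rw [Set.indicator_of_mem (hi.2 (by tauto)), Set.indicator_of_mem h1,
        Set.indicator_of_notMem h2, hFe, hp0 hb]
    · have ha : a ∉ A := fun h => h1 (hB.mem_of_plusAdj h2 (plusAdj_comm.1 hab) h)
      rw [Set.indicator_of_mem (hi.2 (by tauto)), Set.indicator_of_notMem h1,
        Set.indicator_of_mem h2, hFe, hp0 ha]
    · have he : e ∉ edgeBoundary (B i) := by tauto
      rw [Set.indicator_of_notMem he, Set.indicator_of_notMem h1, Set.indicator_of_notMem h2,
        add_zero]
  intro x y
  exact ⟨key (by simp [plusAdj]) horEdge_mem_edgeBoundary horEdge_mem_edgeBoundary (hpot x y).1,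
    key (by simp [plusAdj]) vertEdge_mem_edgeBoundary vertEdge_mem_edgeBoundary (hpot x y).2⟩

end IsPlusSeparated

/-- The graph on indices in which two distinct sets of edges are adjacent when they share a
corner. -/
abbrev cornerGraph {ι : Type*} (E : ι → Set (Sym2 GridV)) : SimpleGraph ι :=
  SimpleGraph.fromRel fun i j => (vertexSetOf (E i) ∩ vertexSetOf (E j)).Nonempty

lemma cornerGraph_adj {ι : Type*} {E : ι → Set (Sym2 GridV)} {i j : ι} :
    (cornerGraph E).Adj i j ↔ i ≠ j ∧ ∃ v ∈ vertexSetOf (E i), v ∈ vertexSetOf (E j) := by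
  simp only [cornerGraph, SimpleGraph.fromRel_adj, Set.inter_comm (vertexSetOf (E j)), or_self]
  rfl

lemma support_add_subset {F G : Sym2 GridV → ZMod 2} {s : Set (Sym2 GridV)}
    (hF : Function.support F ⊆ s) (hG : Function.support G ⊆ s) :
    Function.support (F + G) ⊆ s :=
  (Function.support_add F G).trans (Set.union_subset hF hG)

lemma chainDeg_zero (u : GridV) : chainDeg 0 u = 0 := by simp [chainDeg]

namespace IsPlusSeparated

variable {ι : Type*} {A : Set GridV} {B : ι → Set GridV} (hB : IsPlusSeparated A B)
  (hcyc : ∀ i, IsCycle (edgeBoundary (B i)))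

include hB hcyc

/-- Walking through the corner graph without using the adjacency of `i` and `j` produces a chain
starting at their common corner which leaves it along the boundary of `B i`. -/
lemma exists_chain_of_reachable {i j k : ι} (hij : i ≠ j) {v : GridV}
    (hi : v ∈ vertexSetOf (edgeBoundary (B i))) (hj : v ∈ vertexSetOf (edgeBoundary (B j)))
    (hk : ((cornerGraph fun i => edgeBoundary (B i)).deleteEdges {s(i, j)}).Reachable i k)
    {y : GridV} (hy : y ∈ vertexSetOf (edgeBoundary (B k))) (hyv : y ≠ v) :
    ∃ F : Sym2 GridV → ZMod 2, Function.support F ⊆ ⋃ k, edgeBoundary (B k) ∧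
      (∀ u, chainDeg F u = (if u = v then 1 else 0) + (if u = y then 1 else 0)) ∧
      chainDeg ((edgeBoundary (B i)).indicator F) v = 1 := by
  rw [SimpleGraph.reachable_iff_reflTransGen] at hk
  induction hk generalizing y with
  | refl =>
    obtain ⟨F, hF, hdeg⟩ := (hcyc i).exists_arc hi hy
    refine ⟨F, hF.trans (Set.subset_iUnion (fun k => edgeBoundary (B k)) i), hdeg, ?_⟩
    rw [Set.indicator_eq_self.2 hF, hdeg]
    simp [hyv.symm]
  | @tail k l _ hkl ih =>
    rw [SimpleGraph.deleteEdges_adj, cornerGraph_adj, Set.mem_singleton_iff] at hkl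
    obtain ⟨⟨hne, x, hxk, hxl⟩, hnot⟩ := hkl
    have hxv : x ≠ v := by
      rintro rfl
      rcases hB.eq_or_eq_of_mem_vertexSetOf hij hi hj hxk with rfl | rfl <;>
        rcases hB.eq_or_eq_of_mem_vertexSetOf hij hi hj hxl with rfl | rfl <;>
        simp_all [Sym2.eq_swap]
    obtain ⟨F, hF, hdeg, hFv⟩ := ih hxk hxv
    obtain ⟨P, hP, hPdeg⟩ := (hcyc l).exists_arc hxl hy
    refine ⟨F + P, support_add_subset hF (hP.trans
      (Set.subset_iUnion (fun k => edgeBoundary (B k)) l)), fun u => ?_, ?_⟩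
    · rw [chainDeg_add, hdeg, hPdeg, add_assoc, ← add_assoc (ite (u = x) 1 0),
        CharTwo.add_self_eq_zero, zero_add]
    · rw [Set.indicator_add', chainDeg_add, hFv, add_eq_left]
      by_cases hil : i = l
      · subst hil
        rw [Set.indicator_eq_self.2 hP, hPdeg]
        simp [hyv.symm, hxv.symm]
      · rw [hB.indicator_eq_zero hil hP, chainDeg_zero]

lemma isAcyclic_cornerGraph [Finite ι] {C : Set GridV}
    (hA : A = filling C) (hAfin : A.Finite) :
    (cornerGraph fun i => edgeBoundary (B i)).IsAcyclic := by
  rw [SimpleGraph.isAcyclic_iff_forall_adj_isBridge]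
  intro i j hadj
  rw [SimpleGraph.isBridge_iff]
  intro hreach
  obtain ⟨hij, v, hi, hj⟩ := cornerGraph_adj.1 hadj
  obtain ⟨y, hy, hyv⟩ := (hcyc j).exists_mem_vertexSetOf_ne v
  obtain ⟨F, hF, hdeg, hFv⟩ := hB.exists_chain_of_reachable hcyc hij hi hj hreach hy hyv
  obtain ⟨P, hP, hPdeg⟩ := (hcyc j).exists_arc hy hj
  have hsupp : Function.support (F + P) ⊆ edgeBoundary A :=
    (support_add_subset hF (hP.trans (Set.subset_iUnion (fun k => edgeBoundary (B k)) j))).trans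
      (Set.iUnion_subset hB.edgeBoundary_subset)
  obtain ⟨p, hpfin, hpot⟩ := exists_potential (F := F + P)
    ((finite_edgeBoundary hAfin).subset hsupp) fun u => by
      rw [chainDeg_add, hdeg, hPdeg, add_comm (ite (u = y) 1 0), CharTwo.add_self_eq_zero]
  have hp : Function.support p ⊆ A := by
    rw [hA]
    refine subset_filling_of_edgeBoundary_subset hpfin ?_
    refine fun e he => edgeBoundary_filling_subset (hA ▸ hsupp ?_)
    have key (a b : GridV) (h : ¬(a ∈ Function.support p ↔ b ∈ Function.support p)) :
        p a + p b ≠ 0 := by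
      simp only [Function.mem_support] at h
      generalize p a = s at h ⊢
      generalize p b = t at h ⊢
      revert s t
      decide
    rcases edgeBoundary_cases he with ⟨x, y, rfl⟩ | ⟨x, y, rfl⟩
    · rw [Function.mem_support, (hpot x y).1]
      exact key _ _ (horEdge_mem_edgeBoundary.1 he)
    · rw [Function.mem_support, (hpot x y).2]
      exact key _ _ (vertEdge_mem_edgeBoundary.1 he)
  have h0 := (hB.isPotential_indicator hsupp hp hpot i).chainDeg_eq_zero v
  rw [Set.indicator_add', chainDeg_add, hFv, hB.indicator_eq_zero hij hP, chainDeg_zero,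
    add_zero] at h0
  exact one_ne_zero h0

end IsPlusSeparated

lemma zero_mem_starComp {ω : GridV → Prop} (h : (starComp ω).Nonempty) : (0, 0) ∈ starComp ω := by
  obtain ⟨z, hz, hchain⟩ := h
  refine ⟨?_, Relation.ReflTransGen.refl⟩
  rcases hchain.cases_head with rfl | ⟨c, hc, -⟩
  · exact hz
  · exact hc.1

/-- Suppose `C(0)` is finite and nonempty and `E₁, …, Eₙ` enumerate the
distinct outermost boundary cycles (the distinct cycles among `{D_k : S_k ∈ C(0)}`).
Then the graph `H_cyc` on `{1, …, n}`, in which `i ≠ j` are adjacent iff `E i` and `E j`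
share a corner, is a tree. -/
theorem cycle_graph_is_tree (ω : GridV → Prop)
    (hfin : (starComp ω).Finite) (hne : (starComp ω).Nonempty)
    (n : ℕ) (E : Fin n → Set (Sym2 GridV)) (hinj : Function.Injective E)
    (hall : ∀ i, ∃ z ∈ starComp ω, isOutermostCycleOf ω z (E i))
    (hcover : ∀ z ∈ starComp ω, ∀ D, isOutermostCycleOf ω z D → ∃ i, E i = D) :
    (SimpleGraph.fromRel fun i j =>
      (vertexSetOf (E i) ∩ vertexSetOf (E j)).Nonempty).IsTree := by
  set A := filling (starComp ω) with hA
  choose z hz hzE using hall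
  obtain rfl : E = fun i => edgeBoundary (plusComponent A (z i)) :=
    funext fun i => eq_of_isOutermostCycleOf hfin (hz i) (hzE i)
  have hzA (i) : z i ∈ A := subset_filling (hz i)
  have hB : IsPlusSeparated A fun i => plusComponent A (z i) :=
    { subset := fun i => plusComponent_subset (hzA i)
      mem_of_plusAdj := mem_plusComponent_of_plusAdj
      eq_of_mem := fun {i j a} hi hj => hinj <| by
        dsimp only
        rw [← plusComponent_eq_of_mem (hzA i) hi, plusComponent_eq_of_mem (hzA j) hj] }
  have hindex (w) (hw : w ∈ starComp ω) :
      ∃ i, edgeBoundary (plusComponent A (z i)) = edgeBoundary (plusComponent A w) :=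
    hcover w hw _ (isOutermostCycleOf_component hfin hw)
  have hcyc (i) : IsCycle (edgeBoundary (plusComponent A (z i))) :=
    isCycle_edgeBoundary_component hfin (hzA i)
  obtain ⟨i₀, hi₀⟩ := hindex _ (zero_mem_starComp hne)
  have hreach (w) (hw : w ∈ starComp ω) (i)
      (hi : edgeBoundary (plusComponent A (z i)) = edgeBoundary (plusComponent A w)) :
      (cornerGraph fun i => edgeBoundary (plusComponent A (z i))).Reachable i₀ i := by
    obtain ⟨-, hchain⟩ := hw
    induction hchain generalizing i with
    | refl => rw [hinj (hi₀.trans hi.symm)]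
    | @tail b c hb hbc ih =>
      have hbC : b ∈ starComp ω := ⟨hbc.1, hb⟩
      have hcC : c ∈ starComp ω := mem_starComp_of_starAdj hbC hbc.2.2 hbc.2.1
      obtain ⟨k, hk⟩ := hindex b hbC
      by_cases hki : k = i
      · exact hki ▸ ih k hk
      refine (ih k hk).trans (SimpleGraph.Adj.reachable (cornerGraph_adj.2 ⟨hki, ?_⟩))
      have hcb : c ∉ plusComponent A b := fun h => hki <| hinj <| by
        dsimp only
        rw [hk, hi, plusComponent_eq_of_mem (subset_filling hbC) h]
      have hbc' : b ∉ plusComponent A c := fun h => hki <| hinj <| by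
        dsimp only
        rw [hk, hi, plusComponent_eq_of_mem (subset_filling hcC) h]
      obtain ⟨v, hvb, hvc⟩ := exists_isCornerOf_of_starAdj hbc.2.2
      refine ⟨v, ?_, ?_⟩
      · rw [hk]
        exact mem_vertexSetOf_edgeBoundary self_mem_plusComponent hcb hvb hvc
      · rw [hi]
        exact mem_vertexSetOf_edgeBoundary self_mem_plusComponent hbc' hvc hvb
  refine ⟨?_, hB.isAcyclic_cornerGraph hcyc hA (finite_filling hfin)⟩
  rw [SimpleGraph.connected_iff_exists_forall_reachable]
  exact ⟨i₀, fun i => hreach _ (hz i) i rfl⟩
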